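/- Let Ω₁ and Ω₂ be bounded pseudoconvex domains in ℂⁿ with C^k (k ≥ 3)-smooth boundaries, ρ a defining function of Ω₂, and f : ∂Ω₁ → ∂Ω₂ a C^k-smooth CR-diffeomorphism. Then for all p ∈ ∂Ω₁ and all L ∈ Null_p: α_{ρ∘f}(L̄)(p) = α_ρ(conj(f_*(L)))(f(p)) and d^c α_{ρ∘f}(L, L̄)(p) = d^c α_ρ(f_*(L), conj(f_*(L)))(f(p)), where f also denotes a C^k extension of f to ℂⁿ with ∂̄f vanishing on ∂Ω₁ to order k−1, α_{ρ∘f} is the D'Angelo 1-form of the defining function ρ∘f of Ω₁, and α_ρ is the D'Angelo 1-form of ρ. -/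

import Mathlib

open Complex
open scoped ComplexOrder

noncomputable section

/-- Points of ℂⁿ. -/
abbrev Pt (n : ℕ) := Fin n → ℂ

/-- Wirtinger derivative ∂f/∂z_j at z (junk value if f is not differentiable). -/
def dZ (n : ℕ) (f : Pt n → ℂ) (j : Fin n) (z : Pt n) : ℂ :=
  (1 / 2 : ℂ) * (fderiv ℝ f z (Pi.single j 1) - Complex.I * fderiv ℝ f z (Pi.single j Complex.I))

/-- Wirtinger derivative ∂f/∂z̄_j at z. -/
def dZb (n : ℕ) (f : Pt n → ℂ) (j : Fin n) (z : Pt n) : ℂ :=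
  (1 / 2 : ℂ) * (fderiv ℝ f z (Pi.single j 1) + Complex.I * fderiv ℝ f z (Pi.single j Complex.I))

/-- Complexification of a real-valued function. -/
def cR (n : ℕ) (ρ : Pt n → ℝ) : Pt n → ℂ := fun z => (ρ z : ℂ)

/-- Levi form of ρ at z: Levi_ρ(X,Y) = Σ_{j,k} ∂²ρ/∂z_j∂z̄_k X_j conj(Y_k), where X, Y are
(1,0)-vectors given by their coefficient tuples. -/
def levi (n : ℕ) (ρ : Pt n → ℝ) (z : Pt n) (X Y : Fin n → ℂ) : ℂ :=
  ∑ j, ∑ k, dZ n (fun w => dZb n (cR n ρ) k w) j z * X j * (starRingEnd ℂ) (Y k)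

/-- Holomorphic tangent space T^{1,0}_p(∂Ω) (for boundary points p), described via a defining
function: (1,0)-vectors X with Σ_j X_j ∂ρ/∂z_j(p) = 0. -/
def T10 (n : ℕ) (ρ : Pt n → ℝ) (p : Pt n) : Set (Fin n → ℂ) :=
  {X | ∑ j, X j * dZ n (cR n ρ) j p = 0}

/-- Null space of the Levi form inside T^{1,0}_p(∂Ω). -/
def nullSp (n : ℕ) (ρ : Pt n → ℝ) (p : Pt n) : Set (Fin n → ℂ) :=
  {X | X ∈ T10 n ρ p ∧ ∀ Y ∈ T10 n ρ p, levi n ρ p X Y = 0}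

/-- ρ is a C^s defining function of Ω on the neighborhood V of the closure of Ω. -/
def IsDefining (n : ℕ) (s : ℕ∞) (Ω : Set (Pt n)) (ρ : Pt n → ℝ) (V : Set (Pt n)) : Prop :=
  IsOpen V ∧ closure Ω ⊆ V ∧ ContDiffOn ℝ s ρ V ∧
    Ω = {z | z ∈ V ∧ ρ z < 0} ∧ ∀ z ∈ frontier Ω, fderiv ℝ ρ z ≠ 0

/-- Strict plurisubharmonicity on a set, via positivity of the Levi form. -/
def StrictPSHOn (n : ℕ) (f : Pt n → ℝ) (s : Set (Pt n)) : Prop :=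
  ∀ z ∈ s, ∀ X : Fin n → ℂ, X ≠ 0 → 0 < (levi n f z X X).re

/-- Diederich–Fornaess exponent of a defining function ρ (0 if the defining set is empty). -/
def DFexp (n : ℕ) (ρ : Pt n → ℝ) (Ω : Set (Pt n)) : ℝ :=
  sSup {η : ℝ | 0 < η ∧ η < 1 ∧ StrictPSHOn n (fun z => -((-ρ z) ^ η)) Ω}

/-- Diederich–Fornaess index of Ω: supremum over all (C¹) defining functions. -/
def DFindex (n : ℕ) (Ω : Set (Pt n)) : ℝ :=
  sSup {e : ℝ | ∃ ρ V, IsDefining n 1 Ω ρ V ∧ e = DFexp n ρ Ω}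

/-- Steinness exponent of a defining function ρ (⊤ = ∞ if the defining set is empty). -/
def Sexp (n : ℕ) (ρ : Pt n → ℝ) (Ω : Set (Pt n)) : EReal :=
  sInf {e : EReal | ∃ η : ℝ, 1 < η ∧
    (∃ U : Set (Pt n), IsOpen U ∧ frontier Ω ⊆ U ∧
      StrictPSHOn n (fun z => ρ z ^ η) ((closure Ω)ᶜ ∩ U)) ∧ e = (η : EReal)}

/-- Steinness index of Ω: infimum over all (C¹) defining functions. -/
def Sindex (n : ℕ) (Ω : Set (Pt n)) : EReal :=
  sInf {e : EReal | ∃ ρ V, IsDefining n 1 Ω ρ V ∧ e = Sexp n ρ Ω}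

/-- A complex vector field Σ_j a_j ∂/∂z_j + Σ_j b_j ∂/∂z̄_j on ℂⁿ, recorded by its
coefficient functions. -/
structure VF (n : ℕ) where
  a : Pt n → Fin n → ℂ
  b : Pt n → Fin n → ℂ

/-- Action of a complex vector field on a function. -/
def VF.app {n : ℕ} (V : VF n) (f : Pt n → ℂ) (z : Pt n) : ℂ :=
  ∑ j, V.a z j * dZ n f j z + ∑ j, V.b z j * dZb n f j z

/-- The value of a vector field at a point, as a pair ((1,0)-part, (0,1)-part). -/
def VF.atPt {n : ℕ} (V : VF n) (p : Pt n) : (Fin n → ℂ) × (Fin n → ℂ) := (V.a p, V.b p)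

/-- A complex 1-form Σ_j w_j dz_j + Σ_j t_j dz̄_j on ℂⁿ. -/
structure Form1 (n : ℕ) where
  w : Pt n → Fin n → ℂ
  t : Pt n → Fin n → ℂ

/-- Value of a 1-form at a point on a complex tangent vector (pair of (1,0) and (0,1) parts). -/
def Form1.eval {n : ℕ} (η : Form1 n) (z : Pt n) (X : (Fin n → ℂ) × (Fin n → ℂ)) : ℂ :=
  ∑ j, η.w z j * X.1 j + ∑ j, η.t z j * X.2 j

/-- Pairing of a 1-form with a vector field. -/
def Form1.app {n : ℕ} (η : Form1 n) (V : VF n) (z : Pt n) : ℂ :=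
  η.eval z (V.atPt z)

/-- Lie bracket of complex vector fields. -/
def VF.bracket {n : ℕ} (V W : VF n) : VF n :=
  ⟨fun z j => V.app (fun w => W.a w j) z - W.app (fun w => V.a w j) z,
   fun z j => V.app (fun w => W.b w j) z - W.app (fun w => V.b w j) z⟩

/-- Levi-Civita covariant derivative ∇_V W of the Euclidean metric (componentwise derivative). -/
def covD {n : ℕ} (V W : VF n) : VF n :=
  ⟨fun z j => V.app (fun w => W.a w j) z, fun z j => V.app (fun w => W.b w j) z⟩

/-- Lie derivative of a 1-form along a vector field, in coordinates. -/
def lieD {n : ℕ} (T : VF n) (η : Form1 n) : Form1 n :=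
  ⟨fun z j => T.app (fun w => η.w w j) z + ∑ m, η.w z m * dZ n (fun w => T.a w m) j z
      + ∑ m, η.t z m * dZ n (fun w => T.b w m) j z,
   fun z j => T.app (fun w => η.t w j) z + ∑ m, η.w z m * dZb n (fun w => T.a w m) j z
      + ∑ m, η.t z m * dZb n (fun w => T.b w m) j z⟩

/-- Negation of a 1-form. -/
def Form1.neg {n : ℕ} (η : Form1 n) : Form1 n := ⟨fun z j => -η.w z j, fun z j => -η.t z j⟩

/-- Σ_j |∂ρ/∂z_j|². -/
def gradSq (n : ℕ) (ρ : Pt n → ℝ) (z : Pt n) : ℝ :=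
  ∑ j, Complex.normSq (dZ n (cR n ρ) j z)

/-- Norm of the real gradient of ρ: ‖∇ρ‖ = 2 (Σ_j |∂ρ/∂z_j|²)^{1/2}. -/
def gradNorm (n : ℕ) (ρ : Pt n → ℝ) (z : Pt n) : ℝ := 2 * Real.sqrt (gradSq n ρ z)

/-- The (1,0) field L_n = (Σ|∂ρ/∂z_j|²)⁻¹ Σ_j (∂ρ/∂z̄_j) ∂/∂z_j. -/
def LnVF (n : ℕ) (ρ : Pt n → ℝ) : VF n :=
  ⟨fun z j => dZb n (cR n ρ) j z / (gradSq n ρ z : ℂ), fun _ _ => 0⟩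

/-- The (1,0) field N = (Σ|∂ρ/∂z_j|²)^{-1/2} Σ_j (∂ρ/∂z̄_j) ∂/∂z_j. -/
def NVF (n : ℕ) (ρ : Pt n → ℝ) : VF n :=
  ⟨fun z j => dZb n (cR n ρ) j z / ((Real.sqrt (gradSq n ρ z) : ℝ) : ℂ), fun _ _ => 0⟩

/-- T = L_n − conj(L_n). -/
def TVF (n : ℕ) (ρ : Pt n → ℝ) : VF n :=
  ⟨fun z j => (LnVF n ρ).a z j, fun z j => -(starRingEnd ℂ) ((LnVF n ρ).a z j)⟩

/-- η = (1/2)(∂ρ − ∂̄ρ). -/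
def etaF (n : ℕ) (ρ : Pt n → ℝ) : Form1 n :=
  ⟨fun z j => (1 / 2 : ℂ) * dZ n (cR n ρ) j z,
   fun z j => -(1 / 2 : ℂ) * dZb n (cR n ρ) j z⟩

/-- The D'Angelo 1-form α_ρ = −Lie_T η of a defining function ρ. -/
def dAngelo (n : ℕ) (ρ : Pt n → ℝ) : Form1 n := Form1.neg (lieD (TVF n ρ) (etaF n ρ))

/-- Evaluation of the (1,0)-part ∂η of the exterior derivative of a 1-form on two
complex tangent vectors. -/
def delEval {n : ℕ} (η : Form1 n) (X Y : (Fin n → ℂ) × (Fin n → ℂ)) (z : Pt n) : ℂ :=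
  (∑ m, ∑ l, dZ n (fun w => η.w w l) m z * (X.1 m * Y.1 l - Y.1 m * X.1 l)) +
  (∑ m, ∑ l, dZ n (fun w => η.t w l) m z * (X.1 m * Y.2 l - Y.1 m * X.2 l))

/-- Evaluation of ∂̄η of a 1-form η on two complex tangent vectors. -/
def delbEval {n : ℕ} (η : Form1 n) (X Y : (Fin n → ℂ) × (Fin n → ℂ)) (z : Pt n) : ℂ :=
  (∑ m, ∑ l, dZb n (fun w => η.w w l) m z * (X.2 m * Y.1 l - Y.2 m * X.1 l)) +
  (∑ m, ∑ l, dZb n (fun w => η.t w l) m z * (X.2 m * Y.2 l - Y.2 m * X.2 l))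

/-- Evaluation of dη = ∂η + ∂̄η. -/
def dEval {n : ℕ} (η : Form1 n) (X Y : (Fin n → ℂ) × (Fin n → ℂ)) (z : Pt n) : ℂ :=
  delEval η X Y z + delbEval η X Y z

/-- Evaluation of d^c η = i(∂̄ − ∂)η. -/
def dcEval {n : ℕ} (η : Form1 n) (X Y : (Fin n → ℂ) × (Fin n → ℂ)) (z : Pt n) : ℂ :=
  Complex.I * (delbEval η X Y z - delEval η X Y z)

/-- Evaluation of ω ∧ ω̄ on two complex tangent vectors, where ω = π_{1,0} η is the
(1,0)-component of the real 1-form η. -/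
def omegaWedge {n : ℕ} (η : Form1 n) (X Y : (Fin n → ℂ) × (Fin n → ℂ)) (z : Pt n) : ℂ :=
  (∑ j, η.w z j * X.1 j) * (∑ j, (starRingEnd ℂ) (η.w z j) * Y.2 j) -
  (∑ j, η.w z j * Y.1 j) * (∑ j, (starRingEnd ℂ) (η.w z j) * X.2 j)

/-- Evaluation of ∂̄ω where ω = π_{1,0} η. -/
def delbOmega {n : ℕ} (η : Form1 n) (X Y : (Fin n → ℂ) × (Fin n → ℂ)) (z : Pt n) : ℂ :=
  delbEval ⟨η.w, fun _ _ => 0⟩ X Y z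

/-- The standard Euclidean complex Hermitian metric g on complexified tangent vectors
(so that g(∂/∂z_j, ∂/∂z_j) = 1/2). -/
def gMet {n : ℕ} (X Y : (Fin n → ℂ) × (Fin n → ℂ)) : ℂ :=
  (1 / 2 : ℂ) * (∑ j, X.1 j * (starRingEnd ℂ) (Y.1 j) + ∑ j, X.2 j * (starRingEnd ℂ) (Y.2 j))

/-- The real gradient ∇ρ as a complex vector field: 2Σ_j (∂ρ/∂z̄_j ∂/∂z_j + ∂ρ/∂z_j ∂/∂z̄_j). -/
def gradVF (n : ℕ) (ρ : Pt n → ℝ) : VF n :=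
  ⟨fun z j => 2 * dZb n (cR n ρ) j z, fun z j => 2 * dZ n (cR n ρ) j z⟩

/-- Pseudoconvexity of Ω (w.r.t. the defining function ρ): the Levi form is positive
semidefinite on the holomorphic tangent spaces of the boundary. -/
def LeviPseudoconvex (n : ℕ) (ρ : Pt n → ℝ) (Ω : Set (Pt n)) : Prop :=
  ∀ p ∈ frontier Ω, ∀ X ∈ T10 n ρ p, 0 ≤ (levi n ρ p X X).re

/-- The set Σ of weakly pseudoconvex boundary points. -/
def weakPts (n : ℕ) (ρ : Pt n → ℝ) (Ω : Set (Pt n)) : Set (Pt n) :=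
  {p | p ∈ frontier Ω ∧ ∃ X ∈ T10 n ρ p, X ≠ 0 ∧ levi n ρ p X X = 0}

/-- Action of a complex tangent vector at p on a function. -/
def vecApp (n : ℕ) (X : (Fin n → ℂ) × (Fin n → ℂ)) (f : Pt n → ℂ) (p : Pt n) : ℂ :=
  ∑ j, X.1 j * dZ n f j p + ∑ j, X.2 j * dZb n f j p

/-- Pushforward (complexified differential) of a complex tangent vector at p by a map f. -/
def push (n : ℕ) (f : Pt n → Pt n) (p : Pt n) (X : (Fin n → ℂ) × (Fin n → ℂ)) :
    (Fin n → ℂ) × (Fin n → ℂ) :=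
  (fun l => vecApp n X (fun w => f w l) p,
   fun l => vecApp n X (fun w => (starRingEnd ℂ) (f w l)) p)

/-- Conjugation of a coefficient tuple. -/
def conjVec {n : ℕ} (X : Fin n → ℂ) : Fin n → ℂ := fun j => (starRingEnd ℂ) (X j)

/-- A C^k CR-diffeomorphism between ∂Ω₁ and ∂Ω₂, presented by a C^k map f on a
neighborhood U₁ of ∂Ω₁ together with a C^k local inverse g: f maps ∂Ω₁ onto ∂Ω₂
diffeomorphically and its differential maps T^{1,0}(∂Ω₁) into T^{1,0}(∂Ω₂). -/
def IsCRDiffeo (n : ℕ) (k : ℕ∞) (Ω₁ Ω₂ : Set (Pt n)) (ρ₁ ρ₂ : Pt n → ℝ)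
    (f g : Pt n → Pt n) (U₁ U₂ : Set (Pt n)) : Prop :=
  IsOpen U₁ ∧ IsOpen U₂ ∧ frontier Ω₁ ⊆ U₁ ∧ frontier Ω₂ ⊆ U₂ ∧
  (∀ l, ContDiffOn ℝ k (fun z => f z l) U₁) ∧
  (∀ l, ContDiffOn ℝ k (fun z => g z l) U₂) ∧
  f '' frontier Ω₁ = frontier Ω₂ ∧
  (∀ p ∈ frontier Ω₁, g (f p) = p) ∧ (∀ q ∈ frontier Ω₂, f (g q) = q) ∧
  (∀ p ∈ frontier Ω₁, ∀ L ∈ T10 n ρ₁ p,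
    (push n f p (L, 0)).2 = 0 ∧ (push n f p (L, 0)).1 ∈ T10 n ρ₂ (f p))

/-- The 1-form d^c ψ = i(∂̄ψ − ∂ψ) of a real function ψ. -/
def dcForm (n : ℕ) (ψ : Pt n → ℝ) : Form1 n :=
  ⟨fun z j => -Complex.I * dZ n (cR n ψ) j z, fun z j => Complex.I * dZb n (cR n ψ) j z⟩

end

noncomputable section WirtingerCalculus

variable {n : ℕ}

/-- Derivative of `φ` in the direction of the complex tangent vector `u + i v`. -/
def cd (u v : Pt n) (φ : Pt n → ℂ) (z : Pt n) : ℂ :=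
  fderiv ℝ φ z u + I * fderiv ℝ φ z v

/-- Derivative along the constant (1,0)-field with coefficients `X`. -/
def pZ (X : Pt n) (φ : Pt n → ℂ) : Pt n → ℂ :=
  cd ((1 / 2 : ℝ) • X) (-(1 / 2 : ℝ) • (I • X)) φ

/-- Derivative along the conjugate of the constant (1,0)-field with coefficients `X`. -/
def pB (X : Pt n) (φ : Pt n → ℂ) : Pt n → ℂ :=
  cd ((1 / 2 : ℝ) • X) ((1 / 2 : ℝ) • (I • X)) φ

/-- The pointwise conjugate of a function. -/
def cj (φ : Pt n → ℂ) : Pt n → ℂ := fun z => (starRingEnd ℂ) (φ z)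

lemma dZ_eq_pZ (φ : Pt n → ℂ) (j : Fin n) : dZ n φ j = pZ (Pi.single j 1) φ := by
  funext z
  have h : (I • Pi.single j 1 : Pt n) = Pi.single j I := by
    rw [← Pi.single_smul]; simp
  simp only [dZ, pZ, cd, h, map_smul, neg_smul, map_neg, Complex.real_smul]
  push_cast; ring

lemma dZb_eq_pB (φ : Pt n → ℂ) (j : Fin n) : dZb n φ j = pB (Pi.single j 1) φ := by
  funext z
  have h : (I • Pi.single j 1 : Pt n) = Pi.single j I := by
    rw [← Pi.single_smul]; simp
  simp only [dZb, pB, cd, h, map_smul, Complex.real_smul]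
  push_cast; ring

lemma clm_apply_eq_sum (l : Pt n →L[ℝ] ℂ) (y : Pt n) :
    l y = ∑ j, ((1 / 2 : ℂ) * (l (Pi.single j 1) - I * l (Pi.single j I)) * y j +
      (1 / 2 : ℂ) * (l (Pi.single j 1) + I * l (Pi.single j I)) * (starRingEnd ℂ) (y j)) := by
  have hy : y = ∑ j, ((y j).re • (Pi.single j 1 : Pt n) + (y j).im • (Pi.single j I : Pt n)) := by
    funext i
    simp [Finset.sum_apply, Pi.single_apply, Finset.sum_add_distrib]
  conv_lhs => rw [hy]
  simp only [map_sum, map_add, map_smul, Complex.real_smul]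
  refine Finset.sum_congr rfl fun j _ => ?_
  have h1 : (starRingEnd ℂ) (y j) = (y j).re - (y j).im * I := by
    apply Complex.ext <;> simp
  rw [h1]
  linear_combination (-(1 / 2) * (l (Pi.single j 1) - I * l (Pi.single j I))) *
    (Complex.re_add_im (y j)).symm + (y j).im * l (Pi.single j I) * I_sq

lemma fderiv_apply_eq_sum (φ : Pt n → ℂ) (z y : Pt n) :
    fderiv ℝ φ z y =
      ∑ j, (dZ n φ j z * y j + dZb n φ j z * (starRingEnd ℂ) (y j)) :=
  clm_apply_eq_sum _ y

lemma pZ_eq_sum (X : Pt n) (φ : Pt n → ℂ) (z : Pt n) :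
    pZ X φ z = ∑ j, X j * dZ n φ j z := by
  simp only [pZ, cd, fderiv_apply_eq_sum, Finset.mul_sum, ← Finset.sum_add_distrib]
  refine Finset.sum_congr rfl fun j _ => ?_
  simp [Complex.conj_ofNat]
  linear_combination (-(1 / 2) * X j * dZ n φ j z +
    1 / 2 * dZb n φ j z * (starRingEnd ℂ) (X j)) * I_sq

lemma pB_eq_sum (X : Pt n) (φ : Pt n → ℂ) (z : Pt n) :
    pB X φ z = ∑ j, (starRingEnd ℂ) (X j) * dZb n φ j z := by
  simp only [pB, cd, fderiv_apply_eq_sum, Finset.mul_sum, ← Finset.sum_add_distrib]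
  refine Finset.sum_congr rfl fun j _ => ?_
  simp [Complex.conj_ofNat]
  linear_combination ((1 / 2) * X j * dZ n φ j z -
    1 / 2 * dZb n φ j z * (starRingEnd ℂ) (X j)) * I_sq

lemma cd_congr {φ ψ : Pt n → ℂ} {z : Pt n} (h : φ =ᶠ[nhds z] ψ) (u v : Pt n) :
    cd u v φ z = cd u v ψ z := by
  simp [cd, h.fderiv_eq]

lemma contDiffAt_cd {m k : WithTop ℕ∞} {φ : Pt n → ℂ} {z : Pt n} (h : ContDiffAt ℝ k φ z)
    (hmk : m + 1 ≤ k) (u v : Pt n) : ContDiffAt ℝ m (cd u v φ) z := by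
  have h' := h.fderiv_right hmk
  exact (h'.clm_apply contDiffAt_const).add
    (contDiffAt_const.mul (h'.clm_apply contDiffAt_const))

lemma cj_contDiffAt {m : WithTop ℕ∞} {φ : Pt n → ℂ} {z : Pt n} (h : ContDiffAt ℝ m φ z) :
    ContDiffAt ℝ m (cj φ) z :=
  (Complex.conjCLE.contDiff.contDiffAt).comp z h

lemma fderiv_cj (φ : Pt n → ℂ) (z y : Pt n) :
    fderiv ℝ (cj φ) z y = (starRingEnd ℂ) (fderiv ℝ φ z y) := by
  have : cj φ = Complex.conjCLE ∘ φ := rfl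
  rw [this, ContinuousLinearEquiv.comp_fderiv]; simp

lemma cj_cd (u v : Pt n) (φ : Pt n → ℂ) : cj (cd u v φ) = cd u (-v) (cj φ) := by
  funext z
  simp [cj, cd, ← fderiv_cj]

lemma cj_pZ (X : Pt n) (φ : Pt n → ℂ) : cj (pZ X φ) = pB X (cj φ) := by
  rw [pZ, cj_cd, pB]; simp

lemma cj_pB (X : Pt n) (φ : Pt n → ℂ) : cj (pB X φ) = pZ X (cj φ) := by
  rw [pB, cj_cd, pZ]; simp

lemma cd_add {φ ψ : Pt n → ℂ} {z : Pt n} (hφ : DifferentiableAt ℝ φ z)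
    (hψ : DifferentiableAt ℝ ψ z) (u v : Pt n) :
    cd u v (fun w => φ w + ψ w) z = cd u v φ z + cd u v ψ z := by
  simp only [cd, fderiv_fun_add hφ hψ, add_apply]; ring

lemma cd_sub {φ ψ : Pt n → ℂ} {z : Pt n} (hφ : DifferentiableAt ℝ φ z)
    (hψ : DifferentiableAt ℝ ψ z) (u v : Pt n) :
    cd u v (fun w => φ w - ψ w) z = cd u v φ z - cd u v ψ z := by
  simp only [cd, fderiv_fun_sub hφ hψ, sub_apply]; ring

lemma cd_mul {φ ψ : Pt n → ℂ} {z : Pt n} (hφ : DifferentiableAt ℝ φ z)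
    (hψ : DifferentiableAt ℝ ψ z) (u v : Pt n) :
    cd u v (fun w => φ w * ψ w) z = cd u v φ z * ψ z + φ z * cd u v ψ z := by
  simp only [cd, fderiv_fun_mul hφ hψ, add_apply,
    smul_apply, smul_eq_mul]; ring

lemma cd_const (c : ℂ) (z u v : Pt n) : cd u v (fun _ => c) z = 0 := by
  simp [cd]

lemma cd_const_mul {φ : Pt n → ℂ} {z : Pt n} (hφ : DifferentiableAt ℝ φ z) (c : ℂ)
    (u v : Pt n) : cd u v (fun w => c * φ w) z = c * cd u v φ z := by
  rw [cd_mul (differentiableAt_const c) hφ, cd_const]; ring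

lemma cd_sum {ι : Type*} (s : Finset ι) {φ : ι → Pt n → ℂ} {z : Pt n}
    (hφ : ∀ i ∈ s, DifferentiableAt ℝ (φ i) z) (u v : Pt n) :
    cd u v (fun w => ∑ i ∈ s, φ i w) z = ∑ i ∈ s, cd u v (φ i) z := by
  simp only [cd, fderiv_fun_sum hφ, sum_apply, Finset.mul_sum,
    Finset.sum_add_distrib]

lemma fderiv_cd {φ : Pt n → ℂ} {z : Pt n} (h : ContDiffAt ℝ 2 φ z) (u v y : Pt n) :
    fderiv ℝ (cd u v φ) z y = fderiv ℝ (fderiv ℝ φ) z y u + I * fderiv ℝ (fderiv ℝ φ) z y v := by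
  have h' : DifferentiableAt ℝ (fderiv ℝ φ) z :=
    (h.fderiv_right (m := 1) (by norm_num)).differentiableAt (by norm_num)
  have e (u : Pt n) : HasFDerivAt (fun w => fderiv ℝ φ w u)
      ((fderiv ℝ (fderiv ℝ φ) z).flip u) z := by
    simpa using h'.hasFDerivAt.clm_apply (hasFDerivAt_const u z)
  have := ((e u).add ((e v).const_mul I)).fderiv
  change fderiv ℝ (fun w => fderiv ℝ φ w u + I * fderiv ℝ φ w v) z y = _
  erw [this]
  simp

lemma cd_comm {φ : Pt n → ℂ} {z : Pt n} (h : ContDiffAt ℝ 2 φ z) (u v u' v' : Pt n) :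
    cd u v (cd u' v' φ) z = cd u' v' (cd u v φ) z := by
  have hs : IsSymmSndFDerivAt ℝ φ z := h.isSymmSndFDerivAt (by simp)
  rw [cd, cd, fderiv_cd h, fderiv_cd h, fderiv_cd h, fderiv_cd h,
    hs.eq u u', hs.eq u v', hs.eq v u', hs.eq v v']
  ring

lemma cd_comp {φ : Pt n → ℂ} {f : Pt n → Pt n} {z : Pt n}
    (hφ : DifferentiableAt ℝ φ (f z)) (hf : ∀ a, DifferentiableAt ℝ (fun w => f w a) z)
    (u v : Pt n) :
    cd u v (fun w => φ (f w)) z =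
      ∑ a, dZ n φ a (f z) * cd u v (fun w => f w a) z +
      ∑ a, dZb n φ a (f z) * cd u v (cj fun w => f w a) z := by
  have hf' : DifferentiableAt ℝ f z := differentiableAt_pi.2 hf
  have h1 : fderiv ℝ (fun w => φ (f w)) z = (fderiv ℝ φ (f z)).comp (fderiv ℝ f z) :=
    fderiv_comp z hφ hf'
  have h2 (y : Pt n) (a : Fin n) : (fderiv ℝ f z y) a = fderiv ℝ (fun w => f w a) z y := by
    rw [fderiv_pi hf]; rfl
  simp only [cd, h1, ContinuousLinearMap.comp_apply, fderiv_cj,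
    fderiv_apply_eq_sum φ (f z) (fderiv ℝ f z _), h2, Finset.mul_sum, ← Finset.sum_add_distrib]
  refine Finset.sum_congr rfl fun a _ => ?_
  ring

end WirtingerCalculus

section DAngeloForm

variable {n : ℕ}

lemma cj_cR (r : Pt n → ℝ) : cj (cR n r) = cR n r := by
  funext z; simp [cj, cR]

lemma contDiffAt_cR {m : WithTop ℕ∞} {r : Pt n → ℝ} {z : Pt n} (h : ContDiffAt ℝ m r z) :
    ContDiffAt ℝ m (cR n r) z :=
  (Complex.ofRealCLM.contDiff.contDiffAt).comp z h

lemma contDiffAt_dZ {m k : WithTop ℕ∞} {φ : Pt n → ℂ} {z : Pt n} (h : ContDiffAt ℝ k φ z)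
    (hmk : m + 1 ≤ k) (j : Fin n) : ContDiffAt ℝ m (dZ n φ j) z := by
  rw [dZ_eq_pZ]; exact contDiffAt_cd h hmk _ _

lemma contDiffAt_dZb {m k : WithTop ℕ∞} {φ : Pt n → ℂ} {z : Pt n} (h : ContDiffAt ℝ k φ z)
    (hmk : m + 1 ≤ k) (j : Fin n) : ContDiffAt ℝ m (dZb n φ j) z := by
  rw [dZb_eq_pB]; exact contDiffAt_cd h hmk _ _

lemma conj_dZ (φ : Pt n → ℂ) (j : Fin n) (z : Pt n) :
    (starRingEnd ℂ) (dZ n φ j z) = dZb n (cj φ) j z := by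
  rw [dZ_eq_pZ, dZb_eq_pB, ← cj_pZ]; rfl

lemma conj_dZb (φ : Pt n → ℂ) (j : Fin n) (z : Pt n) :
    (starRingEnd ℂ) (dZb n φ j z) = dZ n (cj φ) j z := by
  rw [dZ_eq_pZ, dZb_eq_pB, ← cj_pB]; rfl

lemma cj_dZ (φ : Pt n → ℂ) (j : Fin n) : cj (dZ n φ j) = dZb n (cj φ) j :=
  funext fun z => conj_dZ φ j z

lemma cd_pZ {φ : Pt n → ℂ} {z : Pt n} (h : ContDiffAt ℝ 2 φ z) (u v X : Pt n) :
    cd u v (pZ X φ) z = ∑ j, X j * cd u v (dZ n φ j) z := by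
  have h1 (j : Fin n) : DifferentiableAt ℝ (dZ n φ j) z :=
    (contDiffAt_dZ (m := 1) h (by norm_num) j).differentiableAt (by norm_num)
  have : pZ X φ = fun w => ∑ j, X j * dZ n φ j w := funext (pZ_eq_sum X φ)
  rw [this, cd_sum _ fun j _ => (h1 j).const_mul (X j)]
  exact Finset.sum_congr rfl fun j _ => cd_const_mul (h1 j) _ _ _

lemma cd_pB {φ : Pt n → ℂ} {z : Pt n} (h : ContDiffAt ℝ 2 φ z) (u v X : Pt n) :
    cd u v (pB X φ) z = ∑ j, (starRingEnd ℂ) (X j) * cd u v (dZb n φ j) z := by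
  have h1 (j : Fin n) : DifferentiableAt ℝ (dZb n φ j) z :=
    (contDiffAt_dZb (m := 1) h (by norm_num) j).differentiableAt (by norm_num)
  have : pB X φ = fun w => ∑ j, (starRingEnd ℂ) (X j) * dZb n φ j w := funext (pB_eq_sum X φ)
  rw [this, cd_sum _ fun j _ => (h1 j).const_mul ((starRingEnd ℂ) (X j))]
  exact Finset.sum_congr rfl fun j _ => cd_const_mul (h1 j) _ _ _

lemma cd_cd_pB {φ : Pt n → ℂ} {z : Pt n} (h : ContDiffAt ℝ 3 φ z) (u v u' v' X : Pt n) :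
    cd u v (cd u' v' (pB X φ)) z =
      ∑ j, (starRingEnd ℂ) (X j) * cd u v (cd u' v' (dZb n φ j)) z := by
  have h1 (j : Fin n) : DifferentiableAt ℝ (cd u' v' (dZb n φ j)) z :=
    (contDiffAt_cd (m := 1) (contDiffAt_dZb (m := 2) h (by norm_num) j)
      (by norm_num) u' v').differentiableAt (by norm_num)
  have : cd u' v' (pB X φ) =ᶠ[nhds z]
      fun w => ∑ j, (starRingEnd ℂ) (X j) * cd u' v' (dZb n φ j) w := by
    filter_upwards [h.eventually (by simp)] with w hw
      using cd_pB (hw.of_le (by norm_num)) u' v' X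
  rw [cd_congr this, cd_sum _ fun j _ => (h1 j).const_mul ((starRingEnd ℂ) (X j))]
  exact Finset.sum_congr rfl fun j _ => cd_const_mul (h1 j) _ _ _

lemma ofReal_gradSq (r : Pt n → ℝ) (z : Pt n) :
    (gradSq n r z : ℂ) = ∑ j, dZ n (cR n r) j z * dZb n (cR n r) j z := by
  simp only [gradSq, Complex.ofReal_sum, ← Complex.mul_conj, conj_dZ, cj_cR]

lemma contDiffAt_LnVF {r : Pt n → ℝ} {z : Pt n} (h : ContDiffAt ℝ 3 (cR n r) z)
    (hg : gradSq n r z ≠ 0) (j : Fin n) :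
    ContDiffAt ℝ 2 (fun w => (LnVF n r).a w j) z := by
  have h1 (j : Fin n) := contDiffAt_dZ (m := 2) h (by norm_num) j
  have h2 (j : Fin n) := contDiffAt_dZb (m := 2) h (by norm_num) j
  simp only [LnVF, div_eq_mul_inv]
  refine (h2 j).mul (ContDiffAt.inv ?_ (by exact_mod_cast hg))
  simp only [ofReal_gradSq]
  exact ContDiffAt.sum fun j _ => (h1 j).mul (h2 j)

lemma gradSq_eventually_ne {r : Pt n → ℝ} {z : Pt n} (h : ContDiffAt ℝ 3 (cR n r) z)
    (hg : gradSq n r z ≠ 0) : ∀ᶠ w in nhds z, gradSq n r w ≠ 0 := by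
  have h1 (j : Fin n) := contDiffAt_dZ (m := 2) h (by norm_num) j
  have h2 (j : Fin n) := contDiffAt_dZb (m := 2) h (by norm_num) j
  have hc : ContinuousAt (fun w => (gradSq n r w : ℂ)) z := by
    simp only [ofReal_gradSq]
    exact (ContDiffAt.sum fun j _ => (h1 j).mul (h2 j)).continuousAt
  have : ((gradSq n r z : ℝ) : ℂ) ≠ 0 := by exact_mod_cast hg
  filter_upwards [hc.eventually_ne this] with w hw
  exact_mod_cast hw

lemma sum_LnVF_mul_dZ {r : Pt n → ℝ} {z : Pt n} (hg : gradSq n r z ≠ 0) :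
    ∑ j, (LnVF n r).a z j * dZ n (cR n r) j z = 1 := by
  have hg' : (gradSq n r z : ℂ) ≠ 0 := by exact_mod_cast hg
  simp only [LnVF, div_mul_eq_mul_div, ← Finset.sum_div]
  rw [div_eq_one_iff_eq hg', ofReal_gradSq]
  exact Finset.sum_congr rfl fun j _ => mul_comm _ _

lemma sum_dZ_mul_cd_LnVF {r : Pt n → ℝ} {z : Pt n} (h : ContDiffAt ℝ 3 (cR n r) z)
    (hg : gradSq n r z ≠ 0) (u v : Pt n) :
    ∑ j, dZ n (cR n r) j z * cd u v (fun w => (LnVF n r).a w j) z =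
      -∑ j, (LnVF n r).a z j * cd u v (dZ n (cR n r) j) z := by
  have h1 (j : Fin n) : DifferentiableAt ℝ (dZ n (cR n r) j) z :=
    (contDiffAt_dZ (m := 2) h (by norm_num) j).differentiableAt (by norm_num)
  have h2 (j : Fin n) : DifferentiableAt ℝ (fun w => (LnVF n r).a w j) z :=
    (contDiffAt_LnVF h hg j).differentiableAt (by norm_num)
  have e : (fun w => ∑ j, (LnVF n r).a w j * dZ n (cR n r) j w) =ᶠ[nhds z] fun _ => 1 := by
    filter_upwards [gradSq_eventually_ne h hg] with w hw using sum_LnVF_mul_dZ hw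
  have e' := cd_congr e u v
  rw [cd_const, cd_sum _ fun j _ => (h2 j).fun_mul (h1 j)] at e'
  simp only [cd_mul (h2 _) (h1 _), Finset.sum_add_distrib] at e'
  rw [eq_neg_iff_add_eq_zero, ← e']
  congr 1
  exact Finset.sum_congr rfl fun j _ => mul_comm _ _

lemma sum_dZb_mul_cd_conj_LnVF {r : Pt n → ℝ} {z : Pt n} (h : ContDiffAt ℝ 3 (cR n r) z)
    (hg : gradSq n r z ≠ 0) (u v : Pt n) :
    ∑ j, dZb n (cR n r) j z * cd u v (cj fun w => (LnVF n r).a w j) z =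
      -∑ j, (starRingEnd ℂ) ((LnVF n r).a z j) * cd u v (dZb n (cR n r) j) z := by
  have e := congrArg (starRingEnd ℂ) (sum_dZ_mul_cd_LnVF h hg u (-v))
  have c (φ : Pt n → ℂ) : (starRingEnd ℂ) (cd u (-v) φ z) = cd u v (cj φ) z := by
    have := congrFun (cj_cd u (-v) φ) z
    rwa [neg_neg] at this
  simpa only [map_sum, map_neg, map_mul, c, conj_dZ, cj_dZ, cj_cR] using e

/-- The (0,1)-part of the D'Angelo form is the contraction of `∂∂̄ r` with `L_n`. -/
lemma dAngelo_t {r : Pt n → ℝ} {z : Pt n} (h : ContDiffAt ℝ 3 (cR n r) z)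
    (hg : gradSq n r z ≠ 0) (j : Fin n) :
    (dAngelo n r).t z j = ∑ m, (LnVF n r).a z m * dZ n (dZb n (cR n r) j) m z := by
  have hR : ContDiffAt ℝ 2 (cR n r) z := h.of_le (by norm_num)
  have h2 : DifferentiableAt ℝ (dZb n (cR n r) j) z :=
    (contDiffAt_dZb (m := 2) h (by norm_num) j).differentiableAt (by norm_num)
  have h3 (m : Fin n) : DifferentiableAt ℝ (cj fun w => (LnVF n r).a w m) z :=
    (cj_contDiffAt (contDiffAt_LnVF h hg m)).differentiableAt (by norm_num)
  have e1 := sum_dZ_mul_cd_LnVF h hg ((1 / 2 : ℝ) • Pi.single j 1)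
    ((1 / 2 : ℝ) • (I • Pi.single j 1))
  have e2 := sum_dZb_mul_cd_conj_LnVF h hg ((1 / 2 : ℝ) • Pi.single j 1)
    ((1 / 2 : ℝ) • (I • Pi.single j 1))
  change ∑ m, _ * pB (Pi.single j 1) _ z = -∑ m, _ * pB (Pi.single j 1) _ z at e1
  change ∑ m, _ * pB (Pi.single j 1) _ z = -∑ m, _ * pB (Pi.single j 1) _ z at e2
  simp only [← dZb_eq_pB] at e1 e2
  have c1 (m : Fin n) : dZ n (fun w => -(1 / 2 : ℂ) * dZb n (cR n r) j w) m z =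
      -(1 / 2 : ℂ) * dZ n (dZb n (cR n r) j) m z := by
    rw [dZ_eq_pZ, dZ_eq_pZ]; exact cd_const_mul h2 _ _ _
  have c2 (m : Fin n) : dZb n (fun w => -(1 / 2 : ℂ) * dZb n (cR n r) j w) m z =
      -(1 / 2 : ℂ) * dZb n (dZb n (cR n r) j) m z := by
    rw [dZb_eq_pB _ m, dZb_eq_pB _ m]; exact cd_const_mul h2 _ _ _
  have c3 (m : Fin n) : dZb n (fun w => -(starRingEnd ℂ) ((LnVF n r).a w m)) j z =
      -dZb n (cj fun w => (LnVF n r).a w m) j z := by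
    have := cd_const_mul (h3 m) (-1) ((1 / 2 : ℝ) • Pi.single j 1)
      ((1 / 2 : ℝ) • (I • Pi.single j 1))
    simp only [neg_mul, one_mul] at this
    rw [dZb_eq_pB, dZb_eq_pB]; exact this
  have s1 (m : Fin n) : dZb n (dZ n (cR n r) m) j z = dZ n (dZb n (cR n r) j) m z := by
    simp only [dZ_eq_pZ, dZb_eq_pB]; exact cd_comm hR _ _ _ _
  have s2 (m : Fin n) : dZb n (dZb n (cR n r) m) j z = dZb n (dZb n (cR n r) j) m z := by
    simp only [dZb_eq_pB]; exact cd_comm hR _ _ _ _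
  simp only [s1, s2] at e1 e2
  simp only [dAngelo, Form1.neg, lieD, TVF, etaF, VF.app, c1, c2, c3]
  have t1 : ∑ m, (LnVF n r).a z m * (-(1 / 2 : ℂ) * dZ n (dZb n (cR n r) j) m z) =
      -(1 / 2 : ℂ) * ∑ m, (LnVF n r).a z m * dZ n (dZb n (cR n r) j) m z := by
    rw [Finset.mul_sum]; exact Finset.sum_congr rfl fun m _ => by ring
  have t2 : ∑ m, -(starRingEnd ℂ) ((LnVF n r).a z m) *
      (-(1 / 2 : ℂ) * dZb n (dZb n (cR n r) j) m z) =
      (1 / 2 : ℂ) * ∑ m, (starRingEnd ℂ) ((LnVF n r).a z m) *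
        dZb n (dZb n (cR n r) j) m z := by
    rw [Finset.mul_sum]; exact Finset.sum_congr rfl fun m _ => by ring
  have t3 : ∑ m, (1 / 2 : ℂ) * dZ n (cR n r) m z * dZb n (fun w => (LnVF n r).a w m) j z =
      (1 / 2 : ℂ) * ∑ m, dZ n (cR n r) m z * dZb n (fun w => (LnVF n r).a w m) j z := by
    rw [Finset.mul_sum]; exact Finset.sum_congr rfl fun m _ => by ring
  have t4 : ∑ m, -(1 / 2 : ℂ) * dZb n (cR n r) m z *
      -dZb n (cj fun w => (LnVF n r).a w m) j z =
      (1 / 2 : ℂ) * ∑ m, dZb n (cR n r) m z * dZb n (cj fun w => (LnVF n r).a w m) j z := by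
    rw [Finset.mul_sum]; exact Finset.sum_congr rfl fun m _ => by ring
  rw [t1, t2, t3, t4, e1, e2]
  ring

/-- The D'Angelo form is real. -/
lemma dAngelo_w (r : Pt n → ℝ) (z : Pt n) (j : Fin n) :
    (dAngelo n r).w z j = (starRingEnd ℂ) ((dAngelo n r).t z j) := by
  have a1 : cj (fun w => -(1 / 2 : ℂ) * dZb n (cR n r) j w) =
      fun w => -((1 / 2 : ℂ) * dZ n (cR n r) j w) := by
    funext w; simp [cj, conj_dZb, cj_cR, Complex.conj_ofNat]
  have a2 (m : Fin n) : cj (fun w => -(starRingEnd ℂ) ((LnVF n r).a w m)) =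
      fun w => -(LnVF n r).a w m := by
    funext w; simp [cj]
  have a3 (m : Fin n) : cj (fun w => (LnVF n r).a w m) =
      fun w => -(-(starRingEnd ℂ) ((LnVF n r).a w m)) := by
    funext w; simp [cj]
  have neg1 (φ : Pt n → ℂ) (m : Fin n) : dZ n (fun w => -φ w) m z = -dZ n φ m z := by
    simp only [dZ, fderiv_fun_neg, neg_apply]; ring
  have neg2 (φ : Pt n → ℂ) (m : Fin n) : dZb n (fun w => -φ w) m z = -dZb n φ m z := by
    simp only [dZb, fderiv_fun_neg, neg_apply]; ring
  simp only [dAngelo, Form1.neg, lieD, TVF, etaF, VF.app, map_neg, map_add, map_sum, map_mul,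
    conj_dZ, conj_dZb, a1, a2, cj_cR, Complex.conj_conj]
  simp only [a3, neg1, neg2, map_div₀, map_one, map_ofNat, neg_mul, mul_neg, neg_neg,
    Finset.sum_neg_distrib]
  ring

lemma dAngelo_eval {r : Pt n → ℝ} {z : Pt n} (h : ContDiffAt ℝ 3 (cR n r) z)
    (hg : gradSq n r z ≠ 0) (L : Pt n) :
    Form1.eval (dAngelo n r) z (0, conjVec L) =
      pZ ((LnVF n r).a z) (pB L (cR n r)) z := by
  have hR : ContDiffAt ℝ 2 (cR n r) z := h.of_le (by norm_num)
  have e (m : Fin n) : dZ n (pB L (cR n r)) m z =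
      ∑ l, (starRingEnd ℂ) (L l) * dZ n (dZb n (cR n r) l) m z := by
    simp only [dZ_eq_pZ]; exact cd_pB hR _ _ L
  simp only [Form1.eval, Pi.zero_apply, mul_zero, Finset.sum_const_zero, zero_add,
    dAngelo_t h hg, pZ_eq_sum, e, conjVec, Finset.sum_mul, Finset.mul_sum]
  rw [Finset.sum_comm]
  exact Finset.sum_congr rfl fun m _ => Finset.sum_congr rfl fun l _ => by ring

lemma sum_conj_mul_pZ_dAngelo_t {r : Pt n → ℝ} {p : Pt n} (h : ContDiffAt ℝ 3 (cR n r) p)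
    (hg : gradSq n r p ≠ 0) {L : Pt n} {lam : ℂ}
    (hnull : ∀ j, dZ n (pB L (cR n r)) j p = lam * dZ n (cR n r) j p) :
    ∑ l, (starRingEnd ℂ) (L l) * pZ L (fun w => (dAngelo n r).t w l) p =
      pZ L (pZ ((LnVF n r).a p) (pB L (cR n r))) p -
        lam * pZ L (pZ ((LnVF n r).a p) (cR n r)) p := by
  have hB (l : Fin n) : ContDiffAt ℝ 2 (dZb n (cR n r) l) p :=
    contDiffAt_dZb (m := 2) h (by norm_num) l
  have hpB : ContDiffAt ℝ 2 (pB L (cR n r)) p := contDiffAt_cd (m := 2) h (by norm_num) _ _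
  have hL (m : Fin n) : DifferentiableAt ℝ (fun w => (LnVF n r).a w m) p :=
    (contDiffAt_LnVF h hg m).differentiableAt (by norm_num)
  have hZB (l m : Fin n) : DifferentiableAt ℝ (dZ n (dZb n (cR n r) l) m) p :=
    (contDiffAt_dZ (m := 1) (hB l) (by norm_num) m).differentiableAt (by norm_num)
  have e1 (l : Fin n) : pZ L (fun w => (dAngelo n r).t w l) p =
      ∑ m, (pZ L (fun w => (LnVF n r).a w m) p * dZ n (dZb n (cR n r) l) m p +
        (LnVF n r).a p m * pZ L (dZ n (dZb n (cR n r) l) m) p) := by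
    have : (fun w => (dAngelo n r).t w l) =ᶠ[nhds p]
        fun w => ∑ m, (LnVF n r).a w m * dZ n (dZb n (cR n r) l) m w := by
      filter_upwards [h.eventually (by simp), gradSq_eventually_ne h hg] with w hw hgw
        using dAngelo_t hw hgw l
    rw [pZ, cd_congr this, cd_sum _ fun m _ => (hL m).fun_mul (hZB l m)]
    exact Finset.sum_congr rfl fun m _ => cd_mul (hL m) (hZB l m) _ _
  have e2 (m : Fin n) : ∑ l, (starRingEnd ℂ) (L l) * dZ n (dZb n (cR n r) l) m p =
      lam * dZ n (cR n r) m p := by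
    rw [← hnull]
    simp only [dZ_eq_pZ]
    exact (cd_pB (h.of_le (by norm_num)) _ _ L).symm
  have e3 (m : Fin n) : ∑ l, (starRingEnd ℂ) (L l) * pZ L (dZ n (dZb n (cR n r) l) m) p =
      pZ L (dZ n (pB L (cR n r)) m) p := by
    simp only [dZ_eq_pZ]
    exact (cd_cd_pB h _ _ _ _ L).symm
  have e4 : ∑ m, (LnVF n r).a p m * pZ L (dZ n (pB L (cR n r)) m) p =
      pZ L (pZ ((LnVF n r).a p) (pB L (cR n r))) p := (cd_pZ hpB _ _ _).symm
  have e5 : ∑ m, dZ n (cR n r) m p * pZ L (fun w => (LnVF n r).a w m) p =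
      -pZ L (pZ ((LnVF n r).a p) (cR n r)) p := by
    rw [show pZ L (pZ ((LnVF n r).a p) (cR n r)) p = _ from
      cd_pZ (h.of_le (by norm_num)) _ _ _]
    exact sum_dZ_mul_cd_LnVF h hg _ _
  calc ∑ l, (starRingEnd ℂ) (L l) * pZ L (fun w => (dAngelo n r).t w l) p
      = ∑ m, (pZ L (fun w => (LnVF n r).a w m) p *
            ∑ l, (starRingEnd ℂ) (L l) * dZ n (dZb n (cR n r) l) m p +
          (LnVF n r).a p m *
            ∑ l, (starRingEnd ℂ) (L l) * pZ L (dZ n (dZb n (cR n r) l) m) p) := by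
        simp only [e1, Finset.mul_sum, ← Finset.sum_add_distrib]
        rw [Finset.sum_comm]
        exact Finset.sum_congr rfl fun m _ => Finset.sum_congr rfl fun l _ => by ring
    _ = lam * (∑ m, dZ n (cR n r) m p * pZ L (fun w => (LnVF n r).a w m) p) +
          ∑ m, (LnVF n r).a p m * pZ L (dZ n (pB L (cR n r)) m) p := by
        simp only [e2, e3, Finset.mul_sum, ← Finset.sum_add_distrib]
        exact Finset.sum_congr rfl fun m _ => by ring
    _ = _ := by rw [e4, e5]; ring

lemma dcEval_dAngelo {r : Pt n → ℝ} {p : Pt n} (L : Pt n) :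
    dcEval (dAngelo n r) (L, 0) (0, conjVec L) p =
      -I * (∑ l, (starRingEnd ℂ) (L l) * pZ L (fun w => (dAngelo n r).t w l) p +
        (starRingEnd ℂ)
          (∑ l, (starRingEnd ℂ) (L l) * pZ L (fun w => (dAngelo n r).t w l) p)) := by
  have e (l : Fin n) : (fun w => (dAngelo n r).w w l) = cj fun w => (dAngelo n r).t w l :=
    funext fun w => dAngelo_w r w l
  have s1 : delEval (dAngelo n r) (L, 0) (0, conjVec L) p =
      ∑ l, (starRingEnd ℂ) (L l) * pZ L (fun w => (dAngelo n r).t w l) p := by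
    simp only [delEval, pZ_eq_sum, Finset.mul_sum, conjVec, Pi.zero_apply, mul_zero, zero_mul,
      sub_zero, Finset.sum_const_zero, zero_add]
    rw [Finset.sum_comm]
    exact Finset.sum_congr rfl fun m _ => Finset.sum_congr rfl fun l _ => by ring
  have s2 : delbEval (dAngelo n r) (L, 0) (0, conjVec L) p =
      -(starRingEnd ℂ)
        (∑ l, (starRingEnd ℂ) (L l) * pZ L (fun w => (dAngelo n r).t w l) p) := by
    simp only [delbEval, pZ_eq_sum, Finset.mul_sum, conjVec, Pi.zero_apply, mul_zero, zero_mul,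
      zero_sub, Finset.sum_const_zero, add_zero, map_sum, map_mul, Complex.conj_conj, conj_dZ, e,
      sub_zero, mul_neg, Finset.sum_neg_distrib]
    rw [Finset.sum_comm]
    congr 1
    exact Finset.sum_congr rfl fun m _ => Finset.sum_congr rfl fun l _ => by ring
  rw [dcEval, s1, s2]
  ring

end DAngeloForm

section BoundaryDerivatives

variable {n : ℕ}

lemma pZ_add (X Y : Pt n) (φ : Pt n → ℂ) (z : Pt n) :
    pZ (X + Y) φ z = pZ X φ z + pZ Y φ z := by
  simp [pZ_eq_sum, add_mul, Finset.sum_add_distrib]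

lemma pZ_smul (c : ℂ) (X : Pt n) (φ : Pt n → ℂ) (z : Pt n) :
    pZ (c • X) φ z = c * pZ X φ z := by
  simp [pZ_eq_sum, Finset.mul_sum, mul_assoc]

lemma pZ_sub (X Y : Pt n) (φ : Pt n → ℂ) (z : Pt n) :
    pZ (X - Y) φ z = pZ X φ z - pZ Y φ z := by
  simp [pZ_eq_sum, sub_mul]

lemma mem_T10_iff {r : Pt n → ℝ} {p X : Pt n} : X ∈ T10 n r p ↔ pZ X (cR n r) p = 0 := by
  rw [pZ_eq_sum]; rfl

lemma levi_eq {r : Pt n → ℝ} {z : Pt n} (h : ContDiffAt ℝ 2 (cR n r) z) (X Y : Pt n) :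
    levi n r z X Y = pZ X (pB Y (cR n r)) z := by
  have e (j : Fin n) : dZ n (pB Y (cR n r)) j z =
      ∑ k, (starRingEnd ℂ) (Y k) * dZ n (dZb n (cR n r) k) j z := by
    simp only [dZ_eq_pZ]; exact cd_pB h _ _ Y
  simp only [levi, pZ_eq_sum, e, Finset.mul_sum]
  exact Finset.sum_congr rfl fun j _ => Finset.sum_congr rfl fun k _ => by ring

lemma conj_pZ_pB {r : Pt n → ℝ} {z : Pt n} (h : ContDiffAt ℝ 2 (cR n r) z) (X Y : Pt n) :
    (starRingEnd ℂ) (pZ X (pB Y (cR n r)) z) = pZ Y (pB X (cR n r)) z := by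
  have := congrFun (cj_pZ X (pB Y (cR n r))) z
  rw [cj_pB, cj_cR] at this
  exact this.trans (cd_comm h _ _ _ _)

lemma fderiv_cR {r : Pt n → ℝ} {p : Pt n} (h : DifferentiableAt ℝ r p) (y : Pt n) :
    fderiv ℝ (cR n r) p y = (fderiv ℝ r p y : ℂ) := by
  have : HasFDerivAt (cR n r) (Complex.ofRealCLM.comp (fderiv ℝ r p)) p :=
    Complex.ofRealCLM.hasFDerivAt.comp p h.hasFDerivAt
  rw [this.fderiv]; rfl

lemma exists_fderiv_eq_mul_of_isLocalExtrOn {φ r : Pt n → ℝ} {p : Pt n}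
    (hφ : ContDiffAt ℝ 1 φ p) (hr : ContDiffAt ℝ 1 r p) (hdr : fderiv ℝ r p ≠ 0)
    (hext : IsLocalExtrOn φ {x | r x = r p} p) :
    ∃ c : ℝ, ∀ y, fderiv ℝ φ p y = c * fderiv ℝ r p y := by
  obtain ⟨a, b, hab, h⟩ := hext.exists_multipliers_of_hasStrictFDerivAt_1d
    (hr.hasStrictFDerivAt (by norm_num)) (hφ.hasStrictFDerivAt (by norm_num))
  have hb : b ≠ 0 := by
    rintro rfl
    have ha : a ≠ 0 := by
      rintro rfl
      exact hab rfl
    rw [zero_smul, add_zero, smul_eq_zero] at h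
    exact h.elim ha hdr
  refine ⟨-a / b, fun y => ?_⟩
  have := congrArg (fun l => l y) h
  simp only [add_apply, smul_apply, smul_eq_mul, zero_apply] at this
  field_simp
  linarith

lemma cd_eq_zero_of_vanishing {φ : Pt n → ℂ} {r : Pt n → ℝ} {p : Pt n}
    (hφ : ContDiffAt ℝ 1 φ p) (hr : ContDiffAt ℝ 1 r p) (hdr : fderiv ℝ r p ≠ 0)
    (hφp : φ p = 0) (hz : ∀ᶠ z in nhds p, r z = r p → φ z = 0) {u v : Pt n}
    (huv : cd u v (cR n r) p = 0) : cd u v φ p = 0 := by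
  have hre : ContDiffAt ℝ 1 (fun z => (φ z).re) p :=
    Complex.reCLM.contDiff.contDiffAt.comp p hφ
  have him : ContDiffAt ℝ 1 (fun z => (φ z).im) p :=
    Complex.imCLM.contDiff.contDiffAt.comp p hφ
  have hz' : ∀ᶠ z in nhdsWithin p {x | r x = r p}, φ z = 0 := by
    rw [eventually_nhdsWithin_iff]; exact hz
  obtain ⟨a, ha⟩ := exists_fderiv_eq_mul_of_isLocalExtrOn hre hr hdr
    (Or.inl (by filter_upwards [hz'] with z hz; simp [hz, hφp]))
  obtain ⟨b, hb⟩ := exists_fderiv_eq_mul_of_isLocalExtrOn him hr hdr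
    (Or.inl (by filter_upwards [hz'] with z hz; simp [hz, hφp]))
  have hrd := hr.differentiableAt (by norm_num)
  have hφd := hφ.differentiableAt (by norm_num)
  have e (y : Pt n) : fderiv ℝ φ p y = (a + b * I) * fderiv ℝ (cR n r) p y := by
    have h1 : (fderiv ℝ (fun z => (φ z).re) p y) = (fderiv ℝ φ p y).re := by
      have hd : HasFDerivAt (fun z => (φ z).re) (Complex.reCLM.comp (fderiv ℝ φ p)) p :=
        Complex.reCLM.hasFDerivAt.comp p hφd.hasFDerivAt
      rw [hd.fderiv]; rfl
    have h2 : (fderiv ℝ (fun z => (φ z).im) p y) = (fderiv ℝ φ p y).im := by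
      have hd : HasFDerivAt (fun z => (φ z).im) (Complex.imCLM.comp (fderiv ℝ φ p)) p :=
        Complex.imCLM.hasFDerivAt.comp p hφd.hasFDerivAt
      rw [hd.fderiv]; rfl
    rw [fderiv_cR hrd, ← Complex.re_add_im (fderiv ℝ φ p y), ← h1, ← h2, ha, hb]
    push_cast; ring
  rw [cd, e, e]
  rw [cd] at huv
  linear_combination (a + b * I) * huv

lemma levi_comb (r : Pt n → ℝ) (z X Y : Pt n) (a b : ℂ) :
    levi n r z (a • X - b • Y) (a • X - b • Y) =
      a * (starRingEnd ℂ) a * levi n r z X X - a * (starRingEnd ℂ) b * levi n r z X Y -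
        b * (starRingEnd ℂ) a * levi n r z Y X + b * (starRingEnd ℂ) b * levi n r z Y Y := by
  simp only [levi, Finset.mul_sum, ← Finset.sum_sub_distrib, ← Finset.sum_add_distrib]
  refine Finset.sum_congr rfl fun j _ => Finset.sum_congr rfl fun k _ => ?_
  simp only [Pi.sub_apply, Pi.smul_apply, smul_eq_mul, map_sub, map_mul]
  ring

/-- On a pseudoconvex boundary the third-order term of a null vector in tangential directions
is determined by the second-order ones. -/
lemma pZ_pZ_pB_of_null {r : Pt n → ℝ} {q : Pt n} (hr : ContDiffAt ℝ 3 r q)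
    (hdr : fderiv ℝ r q ≠ 0)
    (hpsc : ∀ᶠ z in nhds q, r z = r q → ∀ X ∈ T10 n r z, 0 ≤ (levi n r z X X).re)
    {N Lam D : Pt n} {lam : ℂ} (hN : pZ N (cR n r) q = 1) (hLam : pZ Lam (cR n r) q = 0)
    (hD : pZ D (cR n r) q = 0)
    (hnull : ∀ Y, pZ Y (pB Lam (cR n r)) q = lam * pZ Y (cR n r) q) :
    pZ Lam (pZ D (pB Lam (cR n r))) q = lam * pZ Lam (pZ D (cR n r)) q := by
  have hR := contDiffAt_cR hr
  have hR2 : ContDiffAt ℝ 2 (cR n r) q := hR.of_le (by norm_num)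
  have hZ (X : Pt n) : ContDiffAt ℝ 2 (pZ X (cR n r)) q := contDiffAt_cd hR (by norm_num) _ _
  have hB (X : Pt n) : ContDiffAt ℝ 2 (pB X (cR n r)) q := contDiffAt_cd hR (by norm_num) _ _
  have hZB (X Y : Pt n) : ContDiffAt ℝ 1 (pZ X (pB Y (cR n r))) q :=
    contDiffAt_cd (hB Y) (by norm_num) _ _
  have hs := (hZ N).differentiableAt (by norm_num)
  have hc := (hZ Lam).differentiableAt (by norm_num)
  have hsb := (hB N).differentiableAt (by norm_num)
  have hcb := (hB Lam).differentiableAt (by norm_num)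
  have hd (X Y : Pt n) := (hZB X Y).differentiableAt (by norm_num)
  set W : Pt n → Pt n := fun z => pZ N (cR n r) z • Lam - pZ Lam (cR n r) z • N with hW
  set H : Pt n → ℂ := fun z => levi n r z (W z) (W z) with hH
  have conjZ (X z : Pt n) : (starRingEnd ℂ) (pZ X (cR n r) z) = pB X (cR n r) z := by
    have := congrFun (cj_pZ X (cR n r)) z
    rwa [cj_cR] at this
  have eH : H =ᶠ[nhds q] fun z =>
      pZ N (cR n r) z * pB N (cR n r) z * pZ Lam (pB Lam (cR n r)) z -
        pZ N (cR n r) z * pB Lam (cR n r) z * pZ Lam (pB N (cR n r)) z -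
        pZ Lam (cR n r) z * pB N (cR n r) z * pZ N (pB Lam (cR n r)) z +
        pZ Lam (cR n r) z * pB Lam (cR n r) z * pZ N (pB N (cR n r)) z := by
    filter_upwards [hR.eventually (by simp)] with z hz
    have hz2 : ContDiffAt ℝ 2 (cR n r) z := hz.of_le (by norm_num)
    simp only [hH, hW, levi_comb, levi_eq hz2, conjZ]
  have hHc : ContDiffAt ℝ 1 H q := by
    have h1 (X : Pt n) : ContDiffAt ℝ 1 (pZ X (cR n r)) q := (hZ X).of_le (by norm_num)
    have h2 (X : Pt n) : ContDiffAt ℝ 1 (pB X (cR n r)) q := (hB X).of_le (by norm_num)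
    refine ContDiffAt.congr_of_eventuallyEq ?_ eH
    exact (((((h1 N).mul (h2 N)).mul (hZB _ _)).sub (((h1 N).mul (h2 Lam)).mul (hZB _ _))).sub
      (((h1 Lam).mul (h2 N)).mul (hZB _ _))).add (((h1 Lam).mul (h2 Lam)).mul (hZB _ _))
  have hHre : ContDiffAt ℝ 1 (fun z => (H z).re) q :=
    Complex.reCLM.contDiff.contDiffAt.comp q hHc
  have hreal : H =ᶠ[nhds q] cR n fun z => (H z).re := by
    filter_upwards [hR.eventually (by simp)] with z hz
    have hz2 : ContDiffAt ℝ 2 (cR n r) z := hz.of_le (by norm_num)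
    refine (Complex.conj_eq_iff_re.1 ?_).symm
    simp only [hH, levi_eq hz2, conj_pZ_pB hz2]
  have hcbq : pB Lam (cR n r) q = 0 := by rw [← conjZ, hLam, map_zero]
  have hsbq : pB N (cR n r) q = 1 := by rw [← conjZ, hN, map_one]
  have hLL : pZ Lam (pB Lam (cR n r)) q = 0 := by rw [hnull, hLam, mul_zero]
  have hHq : H q = 0 := by
    rw [eH.self_of_nhds]
    beta_reduce
    rw [hLL, hcbq, hLam]; ring
  have hext : IsLocalExtrOn (fun z => (H z).re) {x | r x = r q} q := by
    refine Or.inl ?_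
    have : ∀ᶠ z in nhdsWithin q {x | r x = r q}, ∀ X ∈ T10 n r z, 0 ≤ (levi n r z X X).re := by
      rw [eventually_nhdsWithin_iff]; exact hpsc
    filter_upwards [this] with z hz
    rw [hHq, Complex.zero_re]
    refine hz _ ?_
    rw [mem_T10_iff, hW, pZ_sub, pZ_smul, pZ_smul]
    ring
  obtain ⟨c, hc'⟩ := exists_fderiv_eq_mul_of_isLocalExtrOn hHre (hr.of_le (by norm_num)) hdr hext
  have hrd : DifferentiableAt ℝ r q := hr.differentiableAt (by norm_num)
  have hDH : pZ D H q = 0 := by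
    rw [pZ, cd_congr hreal, cd, fderiv_cR (hHre.differentiableAt (by norm_num)),
      fderiv_cR (hHre.differentiableAt (by norm_num)), hc', hc']
    rw [pZ, cd, fderiv_cR hrd, fderiv_cR hrd] at hD
    push_cast
    linear_combination c * hD
  have hDcb : pZ D (pB Lam (cR n r)) q = 0 := by rw [hnull, hD, mul_zero]
  have key : pZ D H q = pZ D (pZ Lam (pB Lam (cR n r))) q - lam * pZ D (pZ Lam (cR n r)) q := by
    have t1 := (hs.fun_mul hsb).fun_mul (hd Lam Lam)
    have t2 := (hs.fun_mul hcb).fun_mul (hd Lam N)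
    have t3 := (hc.fun_mul hsb).fun_mul (hd N Lam)
    have t4 := (hc.fun_mul hcb).fun_mul (hd N N)
    rw [show pZ D H q = _ from cd_congr eH _ _, cd_add ((t1.fun_sub t2).fun_sub t3) t4,
      cd_sub (t1.fun_sub t2) t3, cd_sub t1 t2, cd_mul (hs.fun_mul hsb) (hd Lam Lam),
      cd_mul (hs.fun_mul hcb) (hd Lam N), cd_mul (hc.fun_mul hsb) (hd N Lam),
      cd_mul (hc.fun_mul hcb) (hd N N), cd_mul hs hcb, cd_mul hc hsb, cd_mul hc hcb,
      hLL, hN, hsbq, hcbq, hLam, hnull N, hN]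
    change _ * _ + _ * pZ D (pZ Lam (pB Lam (cR n r))) q -
      ((_ * _ + _ * pZ D (pB Lam (cR n r)) q) * _ + _) -
      ((pZ D (pZ Lam (cR n r)) q * _ + _) * _ + _) + _ = _
    rw [hDcb]
    ring
  rw [hDH] at key
  rw [show pZ Lam (pZ D (pB Lam (cR n r))) q = pZ D (pZ Lam (pB Lam (cR n r))) q from
      cd_comm (hB Lam) _ _ _ _,
    show pZ Lam (pZ D (cR n r)) q = pZ D (pZ Lam (cR n r)) q from cd_comm hR2 _ _ _ _]
  linear_combination -key

end BoundaryDerivatives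

noncomputable section Transformation

variable {n : ℕ}

/-- The complex Jacobian of `f` at `p` applied to `X`. -/
def jac (f : Pt n → Pt n) (p X : Pt n) : Pt n := fun a => pZ X (fun w => f w a) p

/-- `f` is `C³` at `p` and `∂̄f` vanishes there to first order, and to second order
in the directions of `L` and of its conjugate. -/
structure IsCRJet (f : Pt n → Pt n) (p L : Pt n) : Prop where
  smooth : ∀ a, ContDiffAt ℝ 3 (fun w => f w a) p
  zero : ∀ a X, pB X (fun w => f w a) p = 0
  one : ∀ a X u v, cd u v (pB X fun w => f w a) p = 0
  two : ∀ a X u v, pZ L (cd u v (pB X fun w => f w a)) p = 0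
  two_conj : ∀ a X u v, pB L (cd u v (pB X fun w => f w a)) p = 0

lemma cd_cd_mul {A B : Pt n → ℂ} {z : Pt n} (hA : ContDiffAt ℝ 2 A z) (hB : ContDiffAt ℝ 2 B z)
    (u v u' v' : Pt n) :
    cd u v (cd u' v' fun w => A w * B w) z =
      cd u v (cd u' v' A) z * B z + cd u' v' A z * cd u v B z + cd u v A z * cd u' v' B z +
        A z * cd u v (cd u' v' B) z := by
  have e : cd u' v' (fun w => A w * B w) =ᶠ[nhds z]
      fun w => cd u' v' A w * B w + A w * cd u' v' B w := by
    filter_upwards [hA.eventually (by simp), hB.eventually (by simp)] with w h1 h2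
    exact cd_mul (h1.differentiableAt (by norm_num)) (h2.differentiableAt (by norm_num)) _ _
  have a := hA.differentiableAt (by norm_num)
  have b := hB.differentiableAt (by norm_num)
  have a' := (contDiffAt_cd (m := 1) hA (by norm_num) u' v').differentiableAt (by norm_num)
  have b' := (contDiffAt_cd (m := 1) hB (by norm_num) u' v').differentiableAt (by norm_num)
  rw [cd_congr e, cd_add (a'.fun_mul b) (a.fun_mul b'), cd_mul a' b, cd_mul a b']
  ring

lemma jac_add (f : Pt n → Pt n) (p X Y : Pt n) : jac f p (X + Y) = jac f p X + jac f p Y :=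
  funext fun _ => pZ_add _ _ _ _

lemma jac_smul (f : Pt n → Pt n) (p : Pt n) (c : ℂ) (X : Pt n) :
    jac f p (c • X) = c • jac f p X :=
  funext fun _ => pZ_smul _ _ _ _

namespace IsCRJet

variable {f : Pt n → Pt n} {p L : Pt n}

lemma contDiffAt (hf : IsCRJet f p L) : ContDiffAt ℝ 3 f p := contDiffAt_pi.2 hf.smooth

lemma contDiffAt_comp (hf : IsCRJet f p L) {m : WithTop ℕ∞} (hm : m ≤ 3) {φ : Pt n → ℂ}
    (hφ : ContDiffAt ℝ m φ (f p)) : ContDiffAt ℝ m (fun w => φ (f w)) p :=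
  hφ.comp p (hf.contDiffAt.of_le hm)

lemma pZ_cj (hf : IsCRJet f p L) (X : Pt n) (a : Fin n) :
    pZ X (cj fun w => f w a) p = 0 := by
  rw [← cj_pB, cj, hf.zero, map_zero]

lemma cd_pZ_cj (hf : IsCRJet f p L) (X u v : Pt n) (a : Fin n) :
    cd u v (pZ X (cj fun w => f w a)) p = 0 := by
  have := congrFun (cj_cd u (-v) (pB X fun w => f w a)) p
  rw [cj, hf.one, map_zero, neg_neg, cj_pB] at this
  exact this.symm

lemma pZ_pB_cj (hf : IsCRJet f p L) (X Y : Pt n) (a : Fin n) :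
    pZ X (pB Y (cj fun w => f w a)) p = 0 := by
  have h2 : ContDiffAt ℝ 2 (cj fun w => f w a) p :=
    cj_contDiffAt ((hf.smooth a).of_le (by norm_num))
  rw [show pZ X (pB Y (cj fun w => f w a)) p = pB Y (pZ X (cj fun w => f w a)) p from
    cd_comm h2 _ _ _ _]
  exact hf.cd_pZ_cj _ _ _ _

lemma pZ_pZ_pB_cj (hf : IsCRJet f p L) (X Y : Pt n) (a : Fin n) :
    pZ L (pZ X (pB Y (cj fun w => f w a))) p = 0 := by
  have e : pZ X (pB Y (cj fun w => f w a)) =ᶠ[nhds p]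
      cj (pZ Y (pB X fun w => f w a)) := by
    filter_upwards [(hf.smooth a).eventually (by simp)] with w hw
    have h2 : ContDiffAt ℝ 2 (cj fun w => f w a) w := cj_contDiffAt (hw.of_le (by norm_num))
    rw [cj_pZ, cj_pB]
    exact cd_comm h2 _ _ _ _
  rw [show pZ L (pZ X (pB Y (cj fun w => f w a))) p = _ from cd_congr e _ _]
  change pZ L (cj (pZ Y (pB X fun w => f w a))) p = 0
  rw [← cj_pB, cj, show pB L (pZ Y (pB X fun w => f w a)) p = 0 from hf.two_conj _ _ _ _,
    map_zero]

lemma pB_cj_apply (f : Pt n → Pt n) (p Y : Pt n) (a : Fin n) :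
    pB Y (cj fun w => f w a) p = (starRingEnd ℂ) (jac f p Y a) := by
  rw [← cj_pZ]; rfl

lemma cd_comp_eventually (hf : IsCRJet f p L) {φ : Pt n → ℂ} (hφ : ContDiffAt ℝ 1 φ (f p))
    (u v : Pt n) : cd u v (fun w => φ (f w)) =ᶠ[nhds p] fun z =>
      ∑ a, dZ n φ a (f z) * cd u v (fun w => f w a) z +
        ∑ a, dZb n φ a (f z) * cd u v (cj fun w => f w a) z := by
  have h1 := hf.contDiffAt.continuousAt.eventually (hφ.eventually (by simp))
  have h2 : ∀ᶠ z in nhds p, ContDiffAt ℝ 3 f z := hf.contDiffAt.eventually (by simp)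
  filter_upwards [h1, h2] with z h1 h2
  exact cd_comp (h1.differentiableAt (by norm_num))
    (fun a => (contDiffAt_pi.1 h2 a).differentiableAt (by norm_num)) u v

lemma pZ_comp (hf : IsCRJet f p L) {φ : Pt n → ℂ} (hφ : ContDiffAt ℝ 1 φ (f p)) (X : Pt n) :
    pZ X (fun w => φ (f w)) p = pZ (jac f p X) φ (f p) := by
  rw [show pZ X (fun w => φ (f w)) p = _ from (hf.cd_comp_eventually hφ _ _).self_of_nhds,
    pZ_eq_sum]
  have e (a : Fin n) := hf.pZ_cj X a
  simp only [pZ] at e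
  simp only [e, mul_zero, Finset.sum_const_zero, add_zero]
  exact Finset.sum_congr rfl fun a _ => mul_comm _ _

section SecondOrder

variable {φ : Pt n → ℂ}

lemma cd_pZ_comp (hf : IsCRJet f p L) (hφ : ContDiffAt ℝ 2 φ (f p)) (u v Y : Pt n) :
    cd u v (pZ Y fun w => φ (f w)) p =
      ∑ a, cd u v (fun w => dZ n φ a (f w)) p * jac f p Y a +
        pZ (fun a => cd u v (pZ Y fun w => f w a) p) φ (f p) := by
  have d1 (a : Fin n) : DifferentiableAt ℝ (fun w => dZ n φ a (f w)) p :=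
    (hf.contDiffAt_comp (m := 1) (by norm_num) (contDiffAt_dZ hφ (by norm_num) a)).differentiableAt
      (by norm_num)
  have d2 (a : Fin n) : DifferentiableAt ℝ (fun w => dZb n φ a (f w)) p :=
    (hf.contDiffAt_comp (m := 1) (by norm_num) (contDiffAt_dZb hφ (by norm_num) a)).differentiableAt
      (by norm_num)
  have d3 (a : Fin n) : DifferentiableAt ℝ (pZ Y fun w => f w a) p :=
    (contDiffAt_cd (m := 2) (hf.smooth a) (by norm_num) _ _).differentiableAt (by norm_num)
  have d4 (a : Fin n) : DifferentiableAt ℝ (pZ Y (cj fun w => f w a)) p :=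
    (contDiffAt_cd (m := 2) (cj_contDiffAt (hf.smooth a)) (by norm_num) _ _).differentiableAt
      (by norm_num)
  have e : pZ Y (fun w => φ (f w)) =ᶠ[nhds p] fun z =>
      ∑ a, dZ n φ a (f z) * pZ Y (fun w => f w a) z +
        ∑ a, dZb n φ a (f z) * pZ Y (cj fun w => f w a) z :=
    hf.cd_comp_eventually (hφ.of_le (by norm_num)) _ _
  rw [cd_congr e, cd_add (.fun_sum fun a _ => (d1 a).fun_mul (d3 a))
    (.fun_sum fun a _ => (d2 a).fun_mul (d4 a)), cd_sum _ fun a _ => (d1 a).fun_mul (d3 a),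
    cd_sum _ fun a _ => (d2 a).fun_mul (d4 a)]
  simp only [cd_mul (d1 _) (d3 _), cd_mul (d2 _) (d4 _), hf.pZ_cj, hf.cd_pZ_cj, mul_zero,
    add_zero, Finset.sum_const_zero, Finset.sum_add_distrib, pZ_eq_sum (fun _ => _) φ]
  congr 1
  exact Finset.sum_congr rfl fun a _ => mul_comm _ _

lemma pZ_pZ_comp (hf : IsCRJet f p L) (hφ : ContDiffAt ℝ 2 φ (f p)) (X Y : Pt n) :
    pZ X (pZ Y fun w => φ (f w)) p =
      pZ (jac f p X) (pZ (jac f p Y) φ) (f p) +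
        pZ (fun a => pZ X (pZ Y fun w => f w a) p) φ (f p) := by
  have e (a : Fin n) : pZ X (fun w => dZ n φ a (f w)) p = pZ (jac f p X) (dZ n φ a) (f p) :=
    hf.pZ_comp (contDiffAt_dZ hφ (by norm_num) a) X
  rw [show pZ X (pZ Y fun w => φ (f w)) p = _ from hf.cd_pZ_comp hφ _ _ Y,
    show pZ (jac f p X) (pZ (jac f p Y) φ) (f p) = _ from cd_pZ hφ _ _ _]
  congr 1
  exact Finset.sum_congr rfl fun a _ => (mul_comm _ _).trans (congrArg _ (e a))

lemma pZ_pB_comp (hf : IsCRJet f p L) (hφ : ContDiffAt ℝ 2 φ (f p)) (X Y : Pt n) :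
    pZ X (pB Y fun w => φ (f w)) p = pZ (jac f p X) (pB (jac f p Y) φ) (f p) := by
  have d1 (a : Fin n) : DifferentiableAt ℝ (fun w => dZ n φ a (f w)) p :=
    (hf.contDiffAt_comp (m := 1) (by norm_num) (contDiffAt_dZ hφ (by norm_num) a)).differentiableAt
      (by norm_num)
  have d2 (a : Fin n) : DifferentiableAt ℝ (fun w => dZb n φ a (f w)) p :=
    (hf.contDiffAt_comp (m := 1) (by norm_num) (contDiffAt_dZb hφ (by norm_num) a)).differentiableAt
      (by norm_num)
  have d3 (a : Fin n) : DifferentiableAt ℝ (pB Y fun w => f w a) p :=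
    (contDiffAt_cd (m := 2) (hf.smooth a) (by norm_num) _ _).differentiableAt (by norm_num)
  have d4 (a : Fin n) : DifferentiableAt ℝ (pB Y (cj fun w => f w a)) p :=
    (contDiffAt_cd (m := 2) (cj_contDiffAt (hf.smooth a)) (by norm_num) _ _).differentiableAt
      (by norm_num)
  have e : pB Y (fun w => φ (f w)) =ᶠ[nhds p] fun z =>
      ∑ a, dZ n φ a (f z) * pB Y (fun w => f w a) z +
        ∑ a, dZb n φ a (f z) * pB Y (cj fun w => f w a) z :=
    hf.cd_comp_eventually (hφ.of_le (by norm_num)) _ _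
  have e1 (a : Fin n) := hf.pZ_pB_cj X Y a
  have e2 (a : Fin n) : pZ X (fun w => dZb n φ a (f w)) p = pZ (jac f p X) (dZb n φ a) (f p) :=
    hf.pZ_comp (contDiffAt_dZb hφ (by norm_num) a) X
  rw [show pZ (jac f p X) (pB (jac f p Y) φ) (f p) = _ from cd_pB hφ _ _ _,
    show pZ X (pB Y fun w => φ (f w)) p = _ from cd_congr e _ _,
    cd_add (.fun_sum fun a _ => (d1 a).fun_mul (d3 a))
    (.fun_sum fun a _ => (d2 a).fun_mul (d4 a)), cd_sum _ fun a _ => (d1 a).fun_mul (d3 a),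
    cd_sum _ fun a _ => (d2 a).fun_mul (d4 a)]
  simp only [pZ] at e1 e2
  simp only [cd_mul (d1 _) (d3 _), cd_mul (d2 _) (d4 _), hf.zero, hf.one, e1, e2, mul_zero,
    add_zero, Finset.sum_const_zero, zero_add]
  simp only [pB_cj_apply]
  exact Finset.sum_congr rfl fun a _ => mul_comm _ _

end SecondOrder

lemma pZ_pZ_pB_comp (hf : IsCRJet f p L) {φ : Pt n → ℂ} (hφ : ContDiffAt ℝ 3 φ (f p))
    (X : Pt n) :
    pZ L (pZ X (pB L fun w => φ (f w))) p =
      pZ (jac f p L) (pZ (jac f p X) (pB (jac f p L) φ)) (f p) +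
        pZ (fun a => pZ L (pZ X fun w => f w a) p) (pB (jac f p L) φ) (f p) := by
  have d1 (a : Fin n) : ContDiffAt ℝ 2 (fun w => dZ n φ a (f w)) p :=
    hf.contDiffAt_comp (by norm_num) (contDiffAt_dZ hφ (by norm_num) a)
  have d2 (a : Fin n) : ContDiffAt ℝ 2 (fun w => dZb n φ a (f w)) p :=
    hf.contDiffAt_comp (by norm_num) (contDiffAt_dZb hφ (by norm_num) a)
  have d3 (a : Fin n) : ContDiffAt ℝ 2 (pB L fun w => f w a) p :=
    contDiffAt_cd (hf.smooth a) (by norm_num) _ _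
  have d4 (a : Fin n) : ContDiffAt ℝ 2 (pB L (cj fun w => f w a)) p :=
    contDiffAt_cd (cj_contDiffAt (hf.smooth a)) (by norm_num) _ _
  have m1 (a : Fin n) : ContDiffAt ℝ 2
      (fun z => dZ n φ a (f z) * pB L (fun w => f w a) z) p := (d1 a).mul (d3 a)
  have m2 (a : Fin n) : ContDiffAt ℝ 2
      (fun z => dZb n φ a (f z) * pB L (cj fun w => f w a) z) p := (d2 a).mul (d4 a)
  have e : pB L (fun w => φ (f w)) =ᶠ[nhds p] fun z =>
      ∑ a, dZ n φ a (f z) * pB L (fun w => f w a) z +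
        ∑ a, dZb n φ a (f z) * pB L (cj fun w => f w a) z :=
    hf.cd_comp_eventually (hφ.of_le (by norm_num)) _ _
  have e' : pZ X (pB L fun w => φ (f w)) =ᶠ[nhds p] fun z =>
      ∑ a, pZ X (fun z => dZ n φ a (f z) * pB L (fun w => f w a) z) z +
        ∑ a, pZ X (fun z => dZb n φ a (f z) * pB L (cj fun w => f w a) z) z := by
    have a1 : ∀ᶠ z in nhds p, ∀ a, ContDiffAt ℝ 2
        (fun z => dZ n φ a (f z) * pB L (fun w => f w a) z) z :=
      Filter.eventually_all.2 fun a => (m1 a).eventually (by simp)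
    have a2 : ∀ᶠ z in nhds p, ∀ a, ContDiffAt ℝ 2
        (fun z => dZb n φ a (f z) * pB L (cj fun w => f w a) z) z :=
      Filter.eventually_all.2 fun a => (m2 a).eventually (by simp)
    filter_upwards [e.eventuallyEq_nhds, a1, a2] with z hz a1 a2
    have b1 (a : Fin n) := (a1 a).differentiableAt (by norm_num)
    have b2 (a : Fin n) := (a2 a).differentiableAt (by norm_num)
    rw [show pZ X (pB L fun w => φ (f w)) z = _ from cd_congr hz _ _,
      cd_add (.fun_sum fun a _ => b1 a) (.fun_sum fun a _ => b2 a), cd_sum _ fun a _ => b1 a,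
      cd_sum _ fun a _ => b2 a]
    rfl
  have b1 (a : Fin n) : DifferentiableAt ℝ
      (pZ X (fun z => dZ n φ a (f z) * pB L (fun w => f w a) z)) p :=
    (contDiffAt_cd (m := 1) (m1 a) (by norm_num) _ _).differentiableAt (by norm_num)
  have b2 (a : Fin n) : DifferentiableAt ℝ
      (pZ X (fun z => dZb n φ a (f z) * pB L (cj fun w => f w a) z)) p :=
    (contDiffAt_cd (m := 1) (m2 a) (by norm_num) _ _).differentiableAt (by norm_num)
  have t1 (a : Fin n) :
      pZ L (pZ X (fun z => dZ n φ a (f z) * pB L (fun w => f w a) z)) p = 0 := by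
    have h := hf.two a L ((1 / 2 : ℝ) • X) (-(1 / 2 : ℝ) • (I • X))
    rw [pZ] at h
    rw [show pZ L (pZ X (fun z => dZ n φ a (f z) * pB L (fun w => f w a) z)) p = _ from
      cd_cd_mul (d1 a) (d3 a) _ _ _ _, hf.zero, hf.one, hf.one, h]
    ring
  have t2 (a : Fin n) :
      pZ L (pZ X (fun z => dZb n φ a (f z) * pB L (cj fun w => f w a) z)) p =
        (pZ (jac f p L) (pZ (jac f p X) (dZb n φ a)) (f p) +
          pZ (fun a => pZ L (pZ X fun w => f w a) p) (dZb n φ a) (f p)) *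
          (starRingEnd ℂ) (jac f p L a) := by
    rw [← hf.pZ_pZ_comp (contDiffAt_dZb hφ (by norm_num) a)]
    have h1 := hf.pZ_pB_cj L L a
    have h2 := hf.pZ_pB_cj X L a
    have h3 := hf.pZ_pZ_pB_cj X L a
    rw [pZ] at h1 h2 h3
    rw [pZ] at h3
    rw [show pZ L (pZ X (fun z => dZb n φ a (f z) * pB L (cj fun w => f w a) z)) p = _ from
      cd_cd_mul (d2 a) (d4 a) _ _ _ _, h1, h2, h3, pB_cj_apply]
    simp only [pZ]
    ring
  rw [show pZ L (pZ X (pB L fun w => φ (f w))) p = _ from cd_congr e' _ _,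
    cd_add (.fun_sum fun a _ => b1 a) (.fun_sum fun a _ => b2 a), cd_sum _ fun a _ => b1 a,
    cd_sum _ fun a _ => b2 a,
    show pZ (jac f p L) (pZ (jac f p X) (pB (jac f p L) φ)) (f p) = _ from cd_cd_pB hφ _ _ _ _ _,
    show pZ (fun a => pZ L (pZ X fun w => f w a) p) (pB (jac f p L) φ) (f p) = _ from
      cd_pB (hφ.of_le (by norm_num)) _ _ _, ← Finset.sum_add_distrib, ← Finset.sum_add_distrib]
  refine Finset.sum_congr rfl fun a _ => (congrArg₂ _ (t1 a) (t2 a)).trans ?_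
  simp only [pZ]
  ring

end IsCRJet

end Transformation

section Invariance

variable {n : ℕ}

lemma gradSq_ne_zero {r : Pt n → ℝ} {p : Pt n} (h : DifferentiableAt ℝ r p)
    (hdr : fderiv ℝ r p ≠ 0) : gradSq n r p ≠ 0 := by
  intro h0
  refine hdr (ContinuousLinearMap.ext fun y => ?_)
  have e (j : Fin n) : dZ n (cR n r) j p = 0 :=
    Complex.normSq_eq_zero.1
      ((Finset.sum_eq_zero_iff_of_nonneg fun _ _ => Complex.normSq_nonneg _).1 h0 j
        (Finset.mem_univ j))
  have e' (j : Fin n) : dZb n (cR n r) j p = 0 := by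
    have := conj_dZ (cR n r) j p
    rw [e, map_zero, cj_cR] at this
    exact this.symm
  have := fderiv_apply_eq_sum (cR n r) p y
  simp only [e, e', zero_mul, add_zero, Finset.sum_const_zero, fderiv_cR h] at this
  exact_mod_cast this

lemma pZ_pB_of_mem_nullSp {r : Pt n → ℝ} {p L N : Pt n} (hr : ContDiffAt ℝ 2 (cR n r) p)
    (hL : L ∈ nullSp n r p) (hN : pZ N (cR n r) p = 1) (Y : Pt n) :
    pZ Y (pB L (cR n r)) p = pZ N (pB L (cR n r)) p * pZ Y (cR n r) p := by
  have hY : Y - pZ Y (cR n r) p • N ∈ T10 n r p := by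
    rw [mem_T10_iff, pZ_sub, pZ_smul, hN]; ring
  have h0 := hL.2 _ hY
  rw [levi_eq hr] at h0
  have h1 := conj_pZ_pB hr L (Y - pZ Y (cR n r) p • N)
  rw [h0, map_zero, pZ_sub, pZ_smul] at h1
  linear_combination -h1

lemma pZ_LnVF {r : Pt n → ℝ} {p : Pt n} (hg : gradSq n r p ≠ 0) :
    pZ ((LnVF n r).a p) (cR n r) p = 1 := by
  rw [pZ_eq_sum, sum_LnVF_mul_dZ hg]

lemma pZ_pZ_sub {φ : Pt n → ℂ} {z : Pt n} (h : ContDiffAt ℝ 2 φ z) (L X Y : Pt n) :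
    pZ L (pZ (X - Y) φ) z = pZ L (pZ X φ) z - pZ L (pZ Y φ) z := by
  have e (X : Pt n) : pZ L (pZ X φ) z = _ := cd_pZ h _ _ X
  rw [e, e, e, ← Finset.sum_sub_distrib]
  exact Finset.sum_congr rfl fun j _ => by rw [Pi.sub_apply, sub_mul]

/-- Invariance of the D'Angelo form under a map which is CR to second order. -/
lemma dAngelo_comp {f : Pt n → Pt n} {ρ : Pt n → ℝ} {p L : Pt n} (hf : IsCRJet f p L)
    (hρ : ContDiffAt ℝ 3 ρ (f p)) (hdρ : fderiv ℝ ρ (f p) ≠ 0)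
    (hdr : fderiv ℝ (fun z => ρ (f z)) p ≠ 0)
    (hpsc : ∀ᶠ z in nhds (f p), ρ z = ρ (f p) → ∀ X ∈ T10 n ρ z, 0 ≤ (levi n ρ z X X).re)
    (hsurj : Function.Surjective (jac f p)) (hL : L ∈ nullSp n (fun z => ρ (f z)) p) :
    Form1.eval (dAngelo n fun z => ρ (f z)) p (0, conjVec L) =
        Form1.eval (dAngelo n ρ) (f p) (0, conjVec (jac f p L)) ∧
      dcEval (dAngelo n fun z => ρ (f z)) (L, 0) (0, conjVec L) p =
        dcEval (dAngelo n ρ) (jac f p L, 0) (0, conjVec (jac f p L)) (f p) := by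
  have hr : ContDiffAt ℝ 3 (fun z => ρ (f z)) p := hρ.comp p hf.contDiffAt
  have hgρ := gradSq_ne_zero (hρ.differentiableAt (by norm_num)) hdρ
  have hgr := gradSq_ne_zero (hr.differentiableAt (by norm_num)) hdr
  have hR := contDiffAt_cR hρ
  have hR1 : ContDiffAt ℝ 1 (cR n ρ) (f p) := hR.of_le (by norm_num)
  have hR2 : ContDiffAt ℝ 2 (cR n ρ) (f p) := hR.of_le (by norm_num)
  have hr2 : ContDiffAt ℝ 2 (cR n fun z => ρ (f z)) p :=
    (contDiffAt_cR hr).of_le (by norm_num)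
  have hBR : ContDiffAt ℝ 2 (pB (jac f p L) (cR n ρ)) (f p) :=
    contDiffAt_cd hR (by norm_num) _ _
  have first (X : Pt n) :
      pZ X (cR n fun z => ρ (f z)) p = pZ (jac f p X) (cR n ρ) (f p) := hf.pZ_comp hR1 X
  have second (X : Pt n) : pZ X (pB L (cR n fun z => ρ (f z))) p =
      pZ (jac f p X) (pB (jac f p L) (cR n ρ)) (f p) := hf.pZ_pB_comp hR2 X L
  set ν := (LnVF n fun z => ρ (f z)).a p with hν
  set N := (LnVF n ρ).a (f p) with hN
  have hν1 : pZ ν (cR n fun z => ρ (f z)) p = 1 := pZ_LnVF hgr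
  have hN1 : pZ N (cR n ρ) (f p) = 1 := pZ_LnVF hgρ
  obtain ⟨lam, hlam⟩ : ∃ lam, lam = pZ ν (pB L (cR n fun z => ρ (f z))) p := ⟨_, rfl⟩
  have null₁ (Y : Pt n) : pZ Y (pB L (cR n fun z => ρ (f z))) p =
      lam * pZ Y (cR n fun z => ρ (f z)) p := by
    rw [hlam]; exact pZ_pB_of_mem_nullSp hr2 hL hν1 Y
  have null₂ (Y : Pt n) : pZ Y (pB (jac f p L) (cR n ρ)) (f p) =
      lam * pZ Y (cR n ρ) (f p) := by
    obtain ⟨X, rfl⟩ := hsurj Y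
    rw [← second, ← first, null₁]
  have hL0 : pZ (jac f p L) (cR n ρ) (f p) = 0 := by
    rw [← first, ← mem_T10_iff]; exact hL.1
  refine ⟨?_, ?_⟩
  · rw [dAngelo_eval (contDiffAt_cR hr) hgr, dAngelo_eval hR hgρ, ← hν, ← hN, null₁, null₂,
      hν1, hN1]
  have hD : pZ (jac f p ν - N) (cR n ρ) (f p) = 0 := by
    rw [pZ_sub, ← first, hν1, hN1, sub_self]
  have third := pZ_pZ_pB_of_null hρ hdρ hpsc hN1 hL0 hD null₂
  rw [pZ_pZ_sub hBR, pZ_pZ_sub hR2] at third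
  have e₁ : pZ L (pZ ν (pB L (cR n fun z => ρ (f z)))) p = _ := hf.pZ_pZ_pB_comp hR ν
  have e₂ : pZ L (pZ ν (cR n fun z => ρ (f z))) p = _ := hf.pZ_pZ_comp hR2 L ν
  have j₁ (j : Fin n) : dZ n (pB L (cR n fun z => ρ (f z))) j p =
      lam * dZ n (cR n fun z => ρ (f z)) j p := by
    rw [dZ_eq_pZ, dZ_eq_pZ, null₁]
  have j₂ (j : Fin n) : dZ n (pB (jac f p L) (cR n ρ)) j (f p) =
      lam * dZ n (cR n ρ) j (f p) := by
    rw [dZ_eq_pZ, dZ_eq_pZ, null₂]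
  rw [dcEval_dAngelo, dcEval_dAngelo, sum_conj_mul_pZ_dAngelo_t (contDiffAt_cR hr) hgr j₁,
    sum_conj_mul_pZ_dAngelo_t hR hgρ j₂, ← hν, ← hN, e₁, e₂, null₂,
    show pZ (jac f p L) (pZ (jac f p ν) (pB (jac f p L) (cR n ρ))) (f p) =
      pZ (jac f p L) (pZ N (pB (jac f p L) (cR n ρ))) (f p) + lam *
      (pZ (jac f p L) (pZ (jac f p ν) (cR n ρ)) (f p) -
        pZ (jac f p L) (pZ N (cR n ρ)) (f p)) by linear_combination third]
  ring_nf

namespace IsDefining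

variable {s : ℕ∞} {Ω V : Set (Pt n)} {r : Pt n → ℝ} {p : Pt n}

lemma contDiffAt (h : IsDefining n s Ω r V) (hp : p ∈ frontier Ω) : ContDiffAt ℝ s r p :=
  h.2.2.1.contDiffAt (h.1.mem_nhds (h.2.1 (frontier_subset_closure hp)))

lemma eq_zero (h : IsDefining n s Ω r V) (hΩ : IsOpen Ω) (hp : p ∈ frontier Ω) : r p = 0 := by
  have hV := h.2.1 (frontier_subset_closure hp)
  rw [hΩ.frontier_eq] at hp
  refine le_antisymm ?_ (not_lt.1 fun hlt => hp.2 ?_)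
  · have hc : ContinuousWithinAt r Ω p :=
      (h.contDiffAt (hΩ.frontier_eq ▸ hp)).continuousAt.continuousWithinAt
    refine hc.closure_le hp.1 continuousWithinAt_const fun y hy => ?_
    rw [h.2.2.2.1] at hy
    exact hy.2.le
  · rw [h.2.2.2.1]
    exact ⟨hV, hlt⟩

lemma eventually_mem_frontier (h : IsDefining n s Ω r V) (hΩ : IsOpen Ω) (hs : 1 ≤ s)
    (hp : p ∈ frontier Ω) : ∀ᶠ z in nhds p, r z = 0 → z ∈ frontier Ω := by
  have hr : ContDiffAt ℝ 1 r p := (h.contDiffAt hp).of_le (by exact_mod_cast hs)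
  have hc : ContinuousAt (fderiv ℝ r) p :=
    (hr.fderiv_right (m := 0) (by norm_num)).continuousAt
  filter_upwards [hc.eventually_ne (h.2.2.2.2 p hp),
    h.1.mem_nhds (h.2.1 (frontier_subset_closure hp))] with z hz hzV h0
  rw [hΩ.frontier_eq]
  refine ⟨?_, fun hzΩ => ?_⟩
  · by_contra hcl
    refine hz (IsLocalMin.fderiv_eq_zero ?_)
    filter_upwards [isClosed_closure.isOpen_compl.mem_nhds hcl, h.1.mem_nhds hzV] with y hy hyV
    rw [h0]
    refine not_lt.1 fun hlt => hy (subset_closure ?_)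
    rw [h.2.2.2.1]
    exact ⟨hyV, hlt⟩
  · rw [h.2.2.2.1] at hzΩ
    exact hzΩ.2.ne h0

end IsDefining

lemma IsCRDiffeo.isCRJet {k : ℕ} (hk : 3 ≤ k) {Ω₁ Ω₂ U₁ U₂ V : Set (Pt n)} {r ρ : Pt n → ℝ}
    {f g : Pt n → Pt n} (hΩ : IsOpen Ω₁) (hcr : IsCRDiffeo n (k : ℕ∞) Ω₁ Ω₂ r ρ f g U₁ U₂)
    (hdef : IsDefining n (k : ℕ∞) Ω₁ r V)
    (hdbar : ∀ (l j : Fin n), ∀ p ∈ frontier Ω₁, ∀ m : ℕ, m + 2 ≤ k →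
      iteratedFDeriv ℝ m (fun w => dZb n (fun v => f v l) j w) p = 0)
    {p L : Pt n} (hp : p ∈ frontier Ω₁) (hL : L ∈ T10 n r p) : IsCRJet f p L := by
  have hk' : (3 : WithTop ℕ∞) ≤ ((k : ℕ∞) : WithTop ℕ∞) :=
    WithTop.coe_le_coe.2 (by exact_mod_cast hk : (3 : ℕ∞) ≤ k)
  obtain ⟨hU₁, -, hsub, -, hfs, -⟩ := hcr
  have smooth {q : Pt n} (hq : q ∈ frontier Ω₁) (a : Fin n) :
      ContDiffAt ℝ 3 (fun w => f w a) q :=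
    ((hfs a).contDiffAt (hU₁.mem_nhds (hsub hq))).of_le hk'
  have zero {q : Pt n} (hq : q ∈ frontier Ω₁) (a : Fin n) (X : Pt n) :
      pB X (fun w => f w a) q = 0 := by
    rw [pB_eq_sum]
    refine Finset.sum_eq_zero fun j _ => ?_
    have := congrArg (fun m => m 0) (hdbar a j q hq 0 (by omega))
    simp only [iteratedFDeriv_zero_apply] at this
    rw [this]; simp
  have one {q : Pt n} (hq : q ∈ frontier Ω₁) (a : Fin n) (X u v : Pt n) :
      cd u v (pB X fun w => f w a) q = 0 := by
    rw [cd_pB ((smooth hq a).of_le (by norm_num))]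
    refine Finset.sum_eq_zero fun j _ => ?_
    have e (y : Pt n) : fderiv ℝ (dZb n (fun w => f w a) j) q y = 0 := by
      exact (iteratedFDeriv_one_apply _).symm.trans
        (congrArg (fun m => m fun _ => y) (hdbar a j q hq 1 (by omega)))
    rw [cd, e, e]; simp
  have hr : ContDiffAt ℝ 1 r p := (hdef.contDiffAt hp).of_le (le_trans (by norm_num) hk')
  have hz : ∀ᶠ z in nhds p, r z = r p → z ∈ frontier Ω₁ := by
    rw [hdef.eq_zero hΩ hp]
    exact hdef.eventually_mem_frontier hΩ (by exact_mod_cast (by omega : 1 ≤ k)) hp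
  rw [mem_T10_iff] at hL
  have hL' : pB L (cR n r) p = 0 := by
    rw [← cj_cR r, ← cj_pZ, cj, hL, map_zero]
  have C (a : Fin n) (X u v : Pt n) : ContDiffAt ℝ 1 (cd u v (pB X fun w => f w a)) p :=
    contDiffAt_cd (contDiffAt_cd (m := 2) (smooth hp a) (by norm_num) _ _) (by norm_num) u v
  have vanish (a : Fin n) (X u v : Pt n) :
      ∀ᶠ z in nhds p, r z = r p → cd u v (pB X fun w => f w a) z = 0 :=
    hz.mono fun z h h0 => one (h h0) a X u v
  exact ⟨smooth hp, zero hp, one hp,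
    fun a X u v => cd_eq_zero_of_vanishing (C a X u v) hr (hdef.2.2.2.2 p hp) (one hp a X u v)
      (vanish a X u v) hL,
    fun a X u v => cd_eq_zero_of_vanishing (C a X u v) hr (hdef.2.2.2.2 p hp) (one hp a X u v)
      (vanish a X u v) hL'⟩

lemma pZ_coord (X : Pt n) (j : Fin n) (z : Pt n) : pZ X (fun w => w j) z = X j := by
  have h : HasFDerivAt (fun w : Pt n => w j) (ContinuousLinearMap.proj (R := ℝ) j) z :=
    (ContinuousLinearMap.proj (R := ℝ) (φ := fun _ : Fin n => ℂ) j).hasFDerivAt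
  simp only [pZ, cd, h.fderiv, ContinuousLinearMap.proj_apply, Pi.smul_apply, smul_eq_mul,
    Complex.real_smul]
  push_cast
  linear_combination (-(1 / 2 : ℂ) * X j) * I_mul_I

lemma jac_surjective {f g : Pt n → Pt n} {ρ : Pt n → ℝ} {p L : Pt n} (hf : IsCRJet f p L)
    (hρ : ContDiffAt ℝ 1 ρ (f p)) (hdr : fderiv ℝ (fun z => ρ (f z)) p ≠ 0)
    (hg : ∀ a, ContDiffAt ℝ 1 (fun w => g w a) (f p)) (hgp : g (f p) = p)
    (hz : ∀ᶠ z in nhds p, ρ (f z) = ρ (f p) → g (f z) = z) :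
    Function.Surjective (jac f p) := by
  let J : Pt n →ₗ[ℂ] Pt n :=
    { toFun := jac f p, map_add' := jac_add f p, map_smul' := jac_smul f p }
  suffices h : Function.Injective J from LinearMap.injective_iff_surjective.1 h
  refine (injective_iff_map_eq_zero J).2 fun X (hX : jac f p X = 0) => funext fun j => ?_
  have pZ_zero (φ : Pt n → ℂ) (z : Pt n) : pZ 0 φ z = 0 := by simp [pZ_eq_sum]
  have hf1 : ContDiffAt ℝ 1 f p := hf.contDiffAt.of_le (by norm_num)
  have hr0 : pZ X (cR n fun z => ρ (f z)) p = 0 := by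
    rw [show pZ X (cR n fun z => ρ (f z)) p = _ from hf.pZ_comp (contDiffAt_cR hρ) X, hX, pZ_zero]
  have hgf : ContDiffAt ℝ 1 (fun z => g (f z) j) p := (hg j).comp p hf1
  have hid : ContDiffAt ℝ 1 (fun z : Pt n => z j) p :=
    (ContinuousLinearMap.proj (R := ℝ) (φ := fun _ : Fin n => ℂ) j).contDiff.contDiffAt
  have h0 : pZ X (fun z => g (f z) j - z j) p = 0 :=
    cd_eq_zero_of_vanishing (hgf.sub hid) (hρ.comp p hf1) hdr (by simp [hgp])
      (hz.mono fun z h e => by simp [h e]) hr0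
  rw [show pZ X (fun z => g (f z) j - z j) p = _ from
      cd_sub (hgf.differentiableAt (by norm_num)) (hid.differentiableAt (by norm_num)) _ _] at h0
  have h1 : pZ X (fun z => g (f z) j) p = 0 := by
    rw [hf.pZ_comp (φ := fun w => g w j) (hg j) X, hX, pZ_zero]
  have h2 : pZ X (fun z => g (f z) j) p - pZ X (fun z => z j) p = 0 := h0
  rw [h1, pZ_coord, zero_sub, neg_eq_zero] at h2
  exact h2

end Invariance

/-- Proposition 5.3: CR-invariance of D'Angelo 1-forms: for a CR-diffeo
f : ∂Ω₁ → ∂Ω₂ (extended with ∂̄f vanishing to order k−1 on ∂Ω₁), at every p ∈ ∂Ω₁ and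
L ∈ Null_p one has α_{ρ∘f}(L̄)(p) = α_ρ(conj f_*L)(f p) and
d^cα_{ρ∘f}(L,L̄)(p) = d^cα_ρ(f_*L, conj f_*L)(f p). -/
theorem dAngelo_CR_invariance
    (n k : ℕ) (hn : 2 ≤ n) (hk : 3 ≤ k)
    (Ω₁ Ω₂ : Set (Pt n))
    (h1o : IsOpen Ω₁) (h1c : IsConnected Ω₁) (h1b : Bornology.IsBounded Ω₁)
    (h2o : IsOpen Ω₂) (h2c : IsConnected Ω₂) (h2b : Bornology.IsBounded Ω₂)
    (ρ : Pt n → ℝ) (V₂ : Set (Pt n)) (hdef₂ : IsDefining n (k : ℕ∞) Ω₂ ρ V₂)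
    (hpsc₂ : LeviPseudoconvex n ρ Ω₂)
    (f g : Pt n → Pt n) (U₁ U₂ : Set (Pt n))
    (hcr : IsCRDiffeo n (k : ℕ∞) Ω₁ Ω₂ (fun z => ρ (f z)) ρ f g U₁ U₂)
    (hdbar : ∀ (l j : Fin n), ∀ p ∈ frontier Ω₁, ∀ m : ℕ, m + 2 ≤ k →
      iteratedFDeriv ℝ m (fun w => dZb n (fun v => f v l) j w) p = 0)
    (V₁ : Set (Pt n)) (hdef₁ : IsDefining n (k : ℕ∞) Ω₁ (fun z => ρ (f z)) V₁)
    (hpsc₁ : LeviPseudoconvex n (fun z => ρ (f z)) Ω₁) :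
    ∀ p ∈ frontier Ω₁, ∀ L ∈ nullSp n (fun z => ρ (f z)) p,
      (Form1.eval (dAngelo n (fun z => ρ (f z))) p (0, conjVec L)
        = Form1.eval (dAngelo n ρ) (f p) (0, conjVec ((push n f p (L, 0)).1))) ∧
      dcEval (dAngelo n (fun z => ρ (f z))) (L, 0) (0, conjVec L) p
        = dcEval (dAngelo n ρ) ((push n f p (L, 0)).1, 0)
            (0, conjVec ((push n f p (L, 0)).1)) (f p) := by
  intro p hp L hL
  have hk1 : (1 : ℕ∞) ≤ k := by exact_mod_cast (by omega : 1 ≤ k)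
  have hk3 : (3 : WithTop ℕ∞) ≤ ((k : ℕ∞) : WithTop ℕ∞) :=
    WithTop.coe_le_coe.2 (by exact_mod_cast hk : (3 : ℕ∞) ≤ k)
  have hf : IsCRJet f p L := hcr.isCRJet hk h1o hdef₁ hdbar hp hL.1
  obtain ⟨-, hU₂, -, hsub₂, -, hgs, himg, hgf, -⟩ := hcr
  have hq : f p ∈ frontier Ω₂ := himg ▸ Set.mem_image_of_mem f hp
  have hρ : ContDiffAt ℝ 3 ρ (f p) := (hdef₂.contDiffAt hq).of_le hk3
  have hρp : ρ (f p) = 0 := hdef₂.eq_zero h2o hq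
  have hdr := hdef₁.2.2.2.2 p hp
  have hpsc : ∀ᶠ z in nhds (f p), ρ z = ρ (f p) →
      ∀ X ∈ T10 n ρ z, 0 ≤ (levi n ρ z X X).re := by
    filter_upwards [hdef₂.eventually_mem_frontier h2o hk1 hq] with z hz h0
    exact hpsc₂ z (hz (h0.trans hρp))
  have hsurj : Function.Surjective (jac f p) := by
    refine jac_surjective (g := g) hf (hρ.of_le (by norm_num)) hdr (fun a => ?_) (hgf p hp) ?_
    · exact ((hgs a).contDiffAt (hU₂.mem_nhds (hsub₂ hq))).of_le (le_trans (by norm_num) hk3)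
    · filter_upwards [hdef₁.eventually_mem_frontier h1o hk1 hp] with z hz h0
      exact hgf z (hz (h0.trans hρp))
  have hpush : (push n f p (L, 0)).1 = jac f p L := by
    funext a
    simp [push, vecApp, jac, pZ_eq_sum]
  rw [hpush]
  exact dAngelo_comp hf hρ (hdef₂.2.2.2.2 _ hq) hdr hpsc hsurj hL
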